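/- arXiv:2111.10641 — 7 statements merged into one kernel-verified Lean document; each statement's English description precedes it below -/
import Mathlib

section
/- Fix an integer k ≥ 3, a constant δ ∈ (0,1), and a function p : ℕ → [0,1] with n^{k-1}·p(n) → ∞ as n → ∞. Then asymptotically almost surely, for H ~ H_k(n, p(n)) with M = M(H), the following holds: for every subset S ⊆ {1,...,n} with |S| < δn and every prime q, the rank over ℚ of the submatrix (M^T)_S of M^T consisting of the columns indexed by S equals the rank over ℤ/qℤ of (M^T)_S (reduced mod q). -/
open Finset Filter
open scoped Classical

/-- The set of all possible hyperedges: `k`-element subsets of `{1,...,n}` (as `Fin n`). -/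
def edgeSet (n k : ℕ) : Finset (Finset (Fin n)) := Finset.powersetCard k Finset.univ

/-- The signed incidence matrix of a hypergraph `H` on `Fin n`: rows are vertices, columns are
hyperedges; for `e = {v₁ < v₂ < ⋯ < v_k}` the entry at `(vᵢ, e)` is `(-1)^(i+1)`. -/
def signedInc {n : ℕ} (H : Finset (Finset (Fin n))) : Matrix (Fin n) {e // e ∈ H} ℤ :=
  fun u e => if u ∈ e.1 then (-1 : ℤ) ^ (e.1.filter (fun x => x < u)).card else 0

/-- Probability that `H ~ H_k(n,p)` (each of the `C(n,k)` possible hyperedges included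
independently with probability `p`) satisfies the predicate `P`. -/
noncomputable def erProb (n k : ℕ) (p : ℝ) (P : Finset (Finset (Fin n)) → Prop) : ℝ :=
  ∑ H ∈ (edgeSet n k).powerset.filter (fun H => P H),
    p ^ H.card * (1 - p) ^ ((edgeSet n k).card - H.card)

/-- The cokernel `ℤⁿ / Im M(H)` of the signed incidence matrix. -/
noncomputable abbrev Coker {n : ℕ} (H : Finset (Finset (Fin n))) :=
  (Fin n → ℤ) ⧸ LinearMap.range (Matrix.mulVecLin (signedInc H))

section LinearAlgebra

variable {m n : Type*}

/-- The matrix obtained from `A` by zeroing all entries outside `R × C`. -/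
noncomputable def mask (A : Matrix m n ℤ) (R : Finset m) (C : Finset n) : Matrix m n ℤ :=
  fun i j => if i ∈ R ∧ j ∈ C then A i j else 0

/-- An integer matrix has uniform rank if its rank is the same over every field. -/
def UniformRank [Fintype n] (A : Matrix m n ℤ) : Prop :=
  ∃ r, ∀ (K : Type) [Field K], (A.map (Int.cast : ℤ → K)).rank = r

lemma UniformRank.transpose [Fintype m] [Fintype n] {A : Matrix m n ℤ} (h : UniformRank A) :
    UniformRank A.transpose := by
  obtain ⟨r, hr⟩ := h
  refine ⟨r, fun K _ => ?_⟩
  rw [Matrix.transpose_map, Matrix.rank_transpose, hr]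

lemma mask_transpose (A : Matrix m n ℤ) (R : Finset m) (C : Finset n) :
    (mask A R C).transpose = mask A.transpose C R := by
  ext i j
  simp [mask, and_comm]

lemma rank_eq_rank_add_one_of_row [Fintype m] [Fintype n] {K : Type*} [Field K]
    (B B' : Matrix m n K) (i : m) (j : n)
    (hrow : ∀ l, l ≠ j → B i l = 0) (hij : B i j ≠ 0)
    (hB' : ∀ a b, B' a b = if a = i ∨ b = j then 0 else B a b) :
    B.rank = B'.rank + 1 := by
  rw [Matrix.rank_eq_finrank_span_row, Matrix.rank_eq_finrank_span_row]
  set W := Submodule.span K (Set.range B'.row) with hW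
  have hWj : ∀ w ∈ W, w j = 0 := by
    intro w hw
    have : W ≤ LinearMap.ker (LinearMap.proj (R := K) (φ := fun _ : n => K) j) := by
      rw [hW, Submodule.span_le]
      rintro _ ⟨a, rfl⟩
      simp [Matrix.row, hB']
    simpa using this hw
  have hBi : B.row i = B i j • (Pi.single j 1 : n → K) := by
    ext l
    by_cases hl : l = j
    · subst hl; simp [Matrix.row]
    · simp [Matrix.row, hl, hrow l hl]
  have hBa : ∀ a, a ≠ i → B.row a = B'.row a + B a j • (Pi.single j 1 : n → K) := by
    intro a ha
    ext l
    by_cases hl : l = j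
    · subst hl; simp [Matrix.row, hB']
    · simp [Matrix.row, hB', hl, ha]
  have hB'i : B'.row i = 0 := by
    ext l
    simp [Matrix.row, hB']
  have hspan : Submodule.span K (Set.range B.row) =
      W ⊔ Submodule.span K {(Pi.single j 1 : n → K)} := by
    apply le_antisymm
    · rw [Submodule.span_le]
      rintro _ ⟨a, rfl⟩
      have hs : (Pi.single j 1 : n → K) ∈ Submodule.span K {(Pi.single j 1 : n → K)} :=
        Submodule.mem_span_singleton_self _
      by_cases ha : a = i
      · subst ha
        rw [hBi]
        exact Submodule.mem_sup_right (Submodule.smul_mem _ _ hs)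
      · rw [hBa a ha]
        exact Submodule.add_mem_sup (Submodule.subset_span ⟨a, rfl⟩) (Submodule.smul_mem _ _ hs)
    · have hsingle : (Pi.single j 1 : n → K) ∈ Submodule.span K (Set.range B.row) := by
        have : (Pi.single j 1 : n → K) = (B i j)⁻¹ • B.row i := by
          rw [hBi, smul_smul, inv_mul_cancel₀ hij, one_smul]
        rw [this]
        exact Submodule.smul_mem _ _ (Submodule.subset_span ⟨i, rfl⟩)
      refine sup_le ?_ ?_
      · rw [hW, Submodule.span_le]
        rintro _ ⟨a, rfl⟩
        by_cases ha : a = i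
        · subst ha
          rw [hB'i]
          exact Submodule.zero_mem _
        · rw [← add_sub_cancel_right (B'.row a) (B a j • (Pi.single j 1 : n → K)), ← hBa a ha]
          exact Submodule.sub_mem _ (Submodule.subset_span ⟨a, rfl⟩)
            (Submodule.smul_mem _ _ hsingle)
      · rwa [Submodule.span_singleton_le_iff_mem]
  have hinf : W ⊓ Submodule.span K {(Pi.single j 1 : n → K)} = ⊥ := by
    rw [eq_bot_iff]
    rintro x ⟨hx, hx'⟩
    obtain ⟨c, rfl⟩ := Submodule.mem_span_singleton.1 hx'
    have := hWj _ hx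
    have hc : c = 0 := by simpa using this
    simp [hc]
  have hne : (Pi.single j 1 : n → K) ≠ 0 := by simp
  have := Submodule.finrank_sup_add_finrank_inf_eq W (Submodule.span K {(Pi.single j 1 : n → K)})
  rw [hinf, finrank_bot, finrank_span_singleton hne, add_zero] at this
  rw [hspan, this]

lemma uniformRank_mask_of_row [Fintype m] [Fintype n] [DecidableEq m] [DecidableEq n]
    {A : Matrix m n ℤ}
    (hA : ∀ i j, A i j = 0 ∨ IsUnit (A i j))
    {R : Finset m} {C : Finset n} {i : m} (hi : i ∈ R) {j : n}
    (hj : C.filter (fun j => A i j ≠ 0) = {j})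
    (h : UniformRank (mask A (R.erase i) (C.erase j))) : UniformRank (mask A R C) := by
  obtain ⟨r, hr⟩ := h
  have hj' : j ∈ C ∧ A i j ≠ 0 := by
    have := Finset.mem_singleton_self j
    rw [← hj] at this
    simpa using this
  refine ⟨r + 1, fun K _ => ?_⟩
  rw [← hr K]
  refine rank_eq_rank_add_one_of_row _ _ i j ?_ ?_ ?_
  · intro l hl
    have : l ∉ C.filter (fun j => A i j ≠ 0) := by simp [hj, hl]
    simp only [Finset.mem_filter, not_and, not_not] at this
    simp only [Matrix.map_apply, mask]
    split_ifs with hh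
    · rw [this hh.2, Int.cast_zero]
    · exact Int.cast_zero
  · have hu := (hA i j).resolve_left hj'.2
    have := (hu.map (Int.castRingHom K)).ne_zero
    simpa [mask, hi, hj'.1] using this
  · intro a b
    simp only [Matrix.map_apply, mask, Finset.mem_erase]
    by_cases ha : a = i <;> by_cases hb : b = j <;> simp [ha, hb]

lemma mask_erase_row [DecidableEq m] {A : Matrix m n ℤ} {R : Finset m} {C : Finset n} {i : m}
    (hi : C.filter (fun j => A i j ≠ 0) = ∅) : mask A (R.erase i) C = mask A R C := by
  ext a b
  simp only [mask, Finset.mem_erase]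
  by_cases ha : a = i
  · subst ha
    by_cases hb : b ∈ C
    · have : A a b = 0 := by
        by_contra h0
        exact Finset.notMem_empty b (hi ▸ Finset.mem_filter.2 ⟨hb, h0⟩)
      simp [this]
    · simp [hb]
  · simp [ha]

/-- A matrix with entries `0, ±1` whose bipartite graph of nonzero entries is a forest (expressed
by counting incidences) has uniform rank. -/
lemma uniformRank_mask_of_forest [Fintype m] [Fintype n] {A : Matrix m n ℤ}
    (hA : ∀ i j, A i j = 0 ∨ IsUnit (A i j))
    (R : Finset m) (C : Finset n)
    (h : ∀ R' ⊆ R, ∀ C' ⊆ C, R'.Nonempty ∨ C'.Nonempty →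
      ∑ i ∈ R', (C'.filter (fun j => A i j ≠ 0)).card < R'.card + C'.card) :
    UniformRank (mask A R C) := by
  induction hN : R.card + C.card using Nat.strong_induction_on generalizing R C with
  | _ N ih =>
  subst hN
  by_cases hne : R.Nonempty ∨ C.Nonempty
  · have hlt := h R subset_rfl C subset_rfl hne
    have hcomm : ∑ i ∈ R, (C.filter (fun j => A i j ≠ 0)).card =
        ∑ j ∈ C, (R.filter (fun i => A i j ≠ 0)).card := by
      simp only [Finset.card_filter]
      exact Finset.sum_comm
    have hsub : ∀ R₁ ⊆ R, ∀ C₁ ⊆ C, R₁.card + C₁.card < R.card + C.card →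
        UniformRank (mask A R₁ C₁) := fun R₁ hR₁ C₁ hC₁ hcard =>
      ih _ hcard R₁ C₁ (fun R' hR' C' hC' => h R' (hR'.trans hR₁) C' (hC'.trans hC₁)) rfl
    by_cases hrow : ∃ i ∈ R, (C.filter (fun j => A i j ≠ 0)).card ≤ 1
    · obtain ⟨i, hi, hi1⟩ := hrow
      have hRc := Finset.card_erase_lt_of_mem hi
      rcases Nat.le_one_iff_eq_zero_or_eq_one.1 hi1 with h0 | h1
      · rw [← mask_erase_row (Finset.card_eq_zero.1 h0)]
        exact hsub _ (Finset.erase_subset _ _) _ subset_rfl (by omega)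
      · obtain ⟨j, hj⟩ := Finset.card_eq_one.1 h1
        refine uniformRank_mask_of_row hA hi hj (hsub _ (Finset.erase_subset _ _) _
          (Finset.erase_subset _ _) ?_)
        have := Finset.card_erase_le (s := C) (a := j)
        omega
    by_cases hcol : ∃ j ∈ C, (R.filter (fun i => A i j ≠ 0)).card ≤ 1
    · obtain ⟨j, hj, hj1⟩ := hcol
      have hCc := Finset.card_erase_lt_of_mem hj
      rw [← Matrix.transpose_transpose (mask A R C)]
      apply UniformRank.transpose
      rw [mask_transpose]
      rcases Nat.le_one_iff_eq_zero_or_eq_one.1 hj1 with h0 | h1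
      · rw [← mask_erase_row (A := A.transpose) (Finset.card_eq_zero.1 h0), ← mask_transpose]
        exact (hsub _ subset_rfl _ (Finset.erase_subset _ _) (by omega)).transpose
      · obtain ⟨i, hi⟩ := Finset.card_eq_one.1 h1
        refine uniformRank_mask_of_row (A := A.transpose) (fun a b => hA b a) hj hi ?_
        rw [← mask_transpose]
        refine (hsub _ (Finset.erase_subset _ _) _ (Finset.erase_subset _ _) ?_).transpose
        have := Finset.card_erase_le (s := R) (a := i)
        omega
    push Not at hrow hcol
    have h1 := Finset.card_nsmul_le_sum R _ 2 hrow
    have h2 := Finset.card_nsmul_le_sum C _ 2 hcol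
    simp only [smul_eq_mul] at h1 h2
    omega
  · push Not at hne
    obtain ⟨rfl, rfl⟩ := hne
    refine ⟨0, fun K _ => ?_⟩
    have : (mask A ∅ ∅).map (Int.cast : ℤ → K) = 0 := by
      ext a b
      simp [mask]
    rw [this, Matrix.rank_zero]

lemma rank_submatrix_eq_rank_mask [Fintype m] [Fintype n] (K : Type*) [Field K]
    (A : Matrix m n ℤ) (S : Finset n) :
    ((A.submatrix id (fun j : {x // x ∈ S} => (j : n))).map (Int.cast : ℤ → K)).rank =
      ((mask A Finset.univ S).map (Int.cast : ℤ → K)).rank := by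
  rw [Matrix.rank_eq_finrank_span_cols, Matrix.rank_eq_finrank_span_cols]
  suffices h : Submodule.span K (Set.range
      ((A.submatrix id (fun j : {x // x ∈ S} => (j : n))).map (Int.cast : ℤ → K)).col) =
      Submodule.span K (Set.range ((mask A Finset.univ S).map (Int.cast : ℤ → K)).col) by
    rw [h]
  apply le_antisymm
  · rw [Submodule.span_le]
    rintro _ ⟨j, rfl⟩
    refine Submodule.subset_span ⟨j, ?_⟩
    ext i
    simp [Matrix.col, mask]
  · rw [Submodule.span_le]
    rintro _ ⟨j, rfl⟩
    by_cases hj : j ∈ S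
    · refine Submodule.subset_span ⟨⟨j, hj⟩, ?_⟩
      ext i
      simp [Matrix.col, mask, hj]
    · have h0 : ((mask A Finset.univ S).map (Int.cast : ℤ → K)).col j = 0 := by
        ext i
        simp [Matrix.col, mask, hj]
      rw [h0]
      exact Submodule.zero_mem _

end LinearAlgebra

/-- The weight of `e` used for the exponential moment bound attached to the vertex set `T`. -/
noncomputable def edgeWeight {n : ℕ} (T : Finset (Fin n)) (lam : ℝ) (e : Finset (Fin n)) : ℝ :=
  if (e ∩ T).card = 1 then 0 else lam ^ ((e ∩ T).card - 1)

/-- No edge meets `T` in exactly one vertex, and the edges meeting `T` close a cycle. -/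
def IsObstruction {n : ℕ} (H : Finset (Finset (Fin n))) (T : Finset (Fin n)) : Prop :=
  (∀ e ∈ H, (e ∩ T).card ≠ 1) ∧ T.card ≤ ∑ e ∈ H, ((e ∩ T).card - 1)

lemma sum_powerset_prod_weight {α : Type*} (E : Finset α) (p : ℝ) (w : α → ℝ) :
    ∑ H ∈ E.powerset, p ^ H.card * (1 - p) ^ (E.card - H.card) * ∏ e ∈ H, w e =
      ∏ e ∈ E, (p * w e + (1 - p)) := by
  rw [Finset.prod_add]
  refine Finset.sum_congr rfl fun H hH => ?_
  rw [Finset.prod_mul_distrib, Finset.prod_const, Finset.prod_const,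
    Finset.card_sdiff_of_subset (Finset.mem_powerset.1 hH)]
  ring

lemma card_filter_inter_eq {n : ℕ} (k : ℕ) (T : Finset (Fin n)) {a : ℕ} (ha : a ≤ k) :
    ((edgeSet n k).filter (fun e => (e ∩ T).card = a)).card =
      T.card.choose a * (n - T.card).choose (k - a) := by
  have hc : (Tᶜ : Finset (Fin n)).card = n - T.card := by
    rw [Finset.card_compl, Fintype.card_fin]
  rw [← hc, ← Finset.card_powersetCard, ← Finset.card_powersetCard, ← Finset.card_product]
  have hT : ∀ A B : Finset (Fin n), A ⊆ T → B ⊆ Tᶜ → (A ∪ B) ∩ T = A ∧ (A ∪ B) \ T = B := by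
    intro A B hA hB
    constructor <;> ext x <;> have h1 := @hA x <;> have h2 := @hB x <;>
      simp only [Finset.mem_compl, Finset.mem_inter, Finset.mem_union, Finset.mem_sdiff] at * <;>
      tauto
  refine Finset.card_nbij' (fun e => (e ∩ T, e \ T)) (fun x => x.1 ∪ x.2) ?_ ?_ ?_ ?_
  · intro e he
    simp only [edgeSet, Finset.coe_filter, Finset.mem_powersetCard, Set.mem_ofPred_eq] at he
    have := Finset.card_inter_add_card_sdiff e T
    simp only [Finset.coe_product, Set.mem_prod, Finset.mem_coe, Finset.mem_powersetCard]
    refine ⟨⟨Finset.inter_subset_right, he.2⟩, fun x hx => ?_, by omega⟩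
    simpa using (Finset.mem_sdiff.1 hx).2
  · rintro ⟨A, B⟩ h
    simp only [Finset.coe_product, Set.mem_prod, Finset.mem_coe, Finset.mem_powersetCard] at h
    obtain ⟨⟨hA, hA'⟩, hB, hB'⟩ := h
    have hd : Disjoint A B := Finset.disjoint_of_subset_left hA
      (Finset.disjoint_of_subset_right hB disjoint_compl_right)
    simp only [edgeSet, Finset.coe_filter, Finset.mem_powersetCard, Set.mem_ofPred_eq]
    refine ⟨⟨Finset.subset_univ _, ?_⟩, ?_⟩
    · rw [Finset.card_union_of_disjoint hd]; omega
    · rw [(hT A B hA hB).1, hA']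
  · intro e _
    simp only
    rw [Finset.union_comm]
    exact Finset.sdiff_union_inter e T
  · rintro ⟨A, B⟩ h
    simp only [Finset.coe_product, Set.mem_prod, Finset.mem_coe, Finset.mem_powersetCard] at h
    simp only [(hT A B h.1.1 h.2.1).1, (hT A B h.1.1 h.2.1).2]

lemma erProb_le_prod {n k : ℕ} {p : ℝ} (hp : p ∈ Set.Icc (0 : ℝ) 1) (T : Finset (Fin n))
    {lam : ℝ} (hlam : 1 ≤ lam) :
    erProb n k p (fun H => IsObstruction H T) ≤
      (lam⁻¹) ^ T.card * ∏ e ∈ edgeSet n k, (p * edgeWeight T lam e + (1 - p)) := by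
  have hl0 : 0 < lam := by linarith
  have hq : 0 ≤ 1 - p := by linarith [hp.2]
  have hw : ∀ e, 0 ≤ edgeWeight T lam e := by
    intro e
    unfold edgeWeight
    split_ifs <;> positivity
  rw [← sum_powerset_prod_weight, Finset.mul_sum, erProb, Finset.sum_filter]
  refine Finset.sum_le_sum fun H _ => ?_
  have hc : 0 ≤ p ^ H.card * (1 - p) ^ ((edgeSet n k).card - H.card) :=
    mul_nonneg (pow_nonneg hp.1 _) (pow_nonneg hq _)
  split_ifs with hH
  · have hprod : ∏ e ∈ H, edgeWeight T lam e = lam ^ ∑ e ∈ H, ((e ∩ T).card - 1) := by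
      rw [← Finset.prod_pow_eq_pow_sum]
      refine Finset.prod_congr rfl fun e he => ?_
      rw [edgeWeight, if_neg (hH.1 e he)]
    have hge : 1 ≤ (lam⁻¹) ^ T.card * ∏ e ∈ H, edgeWeight T lam e := by
      rw [hprod, inv_pow, ← div_eq_inv_mul, one_le_div (by positivity)]
      exact pow_le_pow_right₀ hlam hH.2
    nlinarith [mul_le_mul_of_nonneg_left hge hc]
  · exact mul_nonneg (by positivity) (mul_nonneg hc (Finset.prod_nonneg fun e _ => hw e))

lemma prod_le_exp {n k : ℕ} {p : ℝ} (hp : p ∈ Set.Icc (0 : ℝ) 1) (T : Finset (Fin n))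
    {lam : ℝ} (hlam : 1 ≤ lam) :
    ∏ e ∈ edgeSet n k, (p * edgeWeight T lam e + (1 - p)) ≤
      Real.exp (∑ e ∈ edgeSet n k, p * (edgeWeight T lam e - 1)) := by
  rw [Real.exp_sum]
  refine Finset.prod_le_prod (fun e _ => ?_) fun e _ => ?_
  · have : 0 ≤ edgeWeight T lam e := by
      unfold edgeWeight
      split_ifs <;> positivity
    nlinarith [hp.1, hp.2, mul_nonneg hp.1 this]
  · linarith [Real.add_one_le_exp (p * (edgeWeight T lam e - 1))]

lemma sum_edgeWeight_sub_one {n k : ℕ} (hk : 1 ≤ k) (T : Finset (Fin n)) (lam : ℝ) :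
    ∑ e ∈ edgeSet n k, (edgeWeight T lam e - 1) =
      -(T.card * (n - T.card).choose (k - 1) : ℝ) +
      ∑ a ∈ Finset.Icc 2 k, (T.card.choose a * (n - T.card).choose (k - a) : ℝ) *
        (lam ^ (a - 1) - 1) := by
  have hmaps : ∀ e ∈ edgeSet n k, (e ∩ T).card ∈ Finset.range (k + 1) := by
    intro e he
    have := (Finset.mem_powersetCard.1 he).2
    have := Finset.card_le_card (Finset.inter_subset_left (s₁ := e) (s₂ := T))
    rw [Finset.mem_range]
    omega
  rw [← Finset.sum_fiberwise_of_maps_to hmaps]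
  have hfib : ∀ a ∈ Finset.range (k + 1),
      ∑ e ∈ edgeSet n k with (e ∩ T).card = a, (edgeWeight T lam e - 1) =
      (T.card.choose a * (n - T.card).choose (k - a) : ℝ) *
        ((if a = 1 then 0 else lam ^ (a - 1)) - 1) := by
    intro a ha
    rw [← Nat.cast_mul, ← card_filter_inter_eq k T (by simpa [Nat.lt_succ_iff] using ha),
      ← nsmul_eq_mul]
    refine Finset.sum_eq_card_nsmul fun e he => ?_
    rw [edgeWeight, (Finset.mem_filter.1 he).2]
  rw [Finset.sum_congr rfl hfib, Finset.range_eq_Ico,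
    Finset.sum_eq_sum_Ico_succ_bot (by omega), Finset.sum_eq_sum_Ico_succ_bot (by omega)]
  have : Finset.Ico (0 + 1 + 1) (k + 1) = Finset.Icc 2 k := by
    ext; simp
  rw [this]
  have h2 : ∀ a ∈ Finset.Icc 2 k, (T.card.choose a * (n - T.card).choose (k - a) : ℝ) *
        ((if a = 1 then 0 else lam ^ (a - 1)) - 1) =
        (T.card.choose a * (n - T.card).choose (k - a) : ℝ) * (lam ^ (a - 1) - 1) := by
    intro a ha
    rw [if_neg (by have := (Finset.mem_Icc.1 ha).1; omega)]
  rw [Finset.sum_congr rfl h2]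
  simp

/-- First-moment bound for a single vertex set. -/
lemma erProb_isObstruction_le {n k : ℕ} (hk : 1 ≤ k) {p : ℝ} (hp : p ∈ Set.Icc (0 : ℝ) 1)
    (hn : 0 < n) (hω : 1 ≤ (n : ℝ) ^ (k - 1) * p) (T : Finset (Fin n)) (hT : T.Nonempty)
    {c : ℝ} (hc : c * (n : ℝ) ^ (k - 1) ≤ (n - T.card).choose (k - 1)) :
    erProb n k p (fun H => IsObstruction H T) ≤
      (T.card * ((n : ℝ) ^ (k - 1) * p) / n *
        Real.exp (k - c * ((n : ℝ) ^ (k - 1) * p))) ^ T.card := by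
  set ω := (n : ℝ) ^ (k - 1) * p with hωdef
  set s := T.card with hs
  have hs0 : (0 : ℝ) < s := by exact_mod_cast hT.card_pos
  have hn0 : (0 : ℝ) < n := by exact_mod_cast hn
  have hω0 : 0 < ω := by linarith
  set lam := max 1 (n / (s * ω)) with hlamdef
  have hlam : 1 ≤ lam := le_max_left _ _
  have hinv : lam⁻¹ ≤ s * ω / n := by
    rw [← inv_div]
    exact inv_anti₀ (by positivity) (le_max_right _ _)
  have hterm : ∀ a ∈ Finset.Icc 2 k,
      p * ((s.choose a * (n - s).choose (k - a) : ℝ) * (lam ^ (a - 1) - 1)) ≤ s := by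
    intro a ha
    obtain ⟨ha2, hak⟩ := Finset.mem_Icc.1 ha
    rcases le_total (n / (s * ω)) 1 with h | h
    · rw [hlamdef, max_eq_left h]
      simp
    · rw [hlamdef, max_eq_right h]
      have h1 : (s.choose a : ℝ) ≤ (s : ℝ) ^ a := by exact_mod_cast Nat.choose_le_pow s a
      have h2 : ((n - s).choose (k - a) : ℝ) ≤ (n : ℝ) ^ (k - a) := by
        exact_mod_cast (Nat.choose_le_pow _ _).trans (Nat.pow_le_pow_left (Nat.sub_le n s) _)
      have h3 : (n / (s * ω)) ^ (a - 1) - 1 ≤ (n / (s * ω)) ^ (a - 1) := by linarith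
      have h4 : 0 ≤ (n / (s * ω)) ^ (a - 1) - 1 := by linarith [one_le_pow₀ h (n := a - 1)]
      calc p * ((s.choose a * (n - s).choose (k - a) : ℝ) * ((n / (s * ω)) ^ (a - 1) - 1))
          ≤ p * (((s : ℝ) ^ a * (n : ℝ) ^ (k - a)) * (n / (s * ω)) ^ (a - 1)) := by
            have := hp.1
            gcongr
        _ = s * (ω / ω ^ (a - 1)) := by
            obtain ⟨b, rfl⟩ : ∃ b, a = b + 1 := ⟨a - 1, by omega⟩
            have hk' : k - 1 = (k - (b + 1)) + b := by omega
            rw [Nat.add_sub_cancel, div_pow, mul_pow]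
            have : ω = (n : ℝ) ^ (k - (b + 1)) * (n : ℝ) ^ b * p := by
              rw [hωdef, hk', pow_add]
            field_simp
            rw [this]
            ring
        _ ≤ s * 1 := by
            gcongr
            rw [div_le_one (by positivity)]
            exact le_self_pow₀ hω (by omega)
        _ = s := mul_one _
  have hexp : ∑ e ∈ edgeSet n k, p * (edgeWeight T lam e - 1) ≤ s * (k - c * ω) := by
    rw [← Finset.mul_sum, sum_edgeWeight_sub_one hk, mul_add, Finset.mul_sum]
    have h1 := Finset.sum_le_card_nsmul _ _ _ hterm
    have h2 : (Finset.Icc 2 k).card • (s : ℝ) ≤ k * s := by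
      rw [nsmul_eq_mul]
      gcongr
      simp
    have h3 : p * s * (c * (n : ℝ) ^ (k - 1)) ≤ p * s * (n - s).choose (k - 1) :=
      mul_le_mul_of_nonneg_left hc (mul_nonneg hp.1 hs0.le)
    rw [hωdef]
    linarith
  calc erProb n k p (fun H => IsObstruction H T)
      ≤ (lam⁻¹) ^ s * Real.exp (s * (k - c * ω)) := by
        refine (erProb_le_prod hp T hlam).trans ?_
        gcongr
        exact (prod_le_exp hp T hlam).trans (Real.exp_le_exp.2 hexp)
    _ ≤ (s * ω / n) ^ s * Real.exp (s * (k - c * ω)) := by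
        gcongr
    _ = _ := by rw [Real.exp_nat_mul, ← mul_pow]

lemma filter_signedInc_ne_zero {n : ℕ} (H : Finset (Finset (Fin n))) (C : Finset (Fin n))
    (e : {e // e ∈ H}) :
    C.filter (fun v => (signedInc H).transpose e v ≠ 0) = e.1 ∩ C := by
  ext v
  simp [signedInc, and_comm]

/-- If no nonempty subset of `S` is an obstruction, then the columns of `M(H)ᵀ` indexed by `S`
span a space of the same dimension over every field. -/
lemma uniformRank_of_forall_not_isObstruction {n : ℕ} (H : Finset (Finset (Fin n)))
    (S : Finset (Fin n)) (h : ∀ T ⊆ S, T.Nonempty → ¬ IsObstruction H T) :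
    UniformRank (mask (signedInc H).transpose Finset.univ S) := by
  have hA : ∀ e v, (signedInc H).transpose e v = 0 ∨ IsUnit ((signedInc H).transpose e v) := by
    intro e v
    rw [Matrix.transpose_apply, signedInc]
    split_ifs
    · exact Or.inr (isUnit_one.neg.pow _)
    · exact Or.inl rfl
  induction S using Finset.strongInduction with
  | H S ih =>
  by_cases hS : ∃ e ∈ H, (e ∩ S).card = 1
  · obtain ⟨e, he, hcard⟩ := hS
    obtain ⟨v, hv⟩ := Finset.card_eq_one.1 hcard
    have hvS : v ∈ S := (Finset.mem_inter.1 (hv ▸ Finset.mem_singleton_self v)).2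
    refine uniformRank_mask_of_row (i := ⟨e, he⟩) (j := v) hA (Finset.mem_univ _) ?_ ?_
    · rw [filter_signedInc_ne_zero, hv]
    · rw [mask_erase_row]
      · exact ih _ (Finset.erase_ssubset hvS)
          fun T hT => h T (hT.trans (Finset.erase_subset _ _))
      · rw [filter_signedInc_ne_zero, Finset.inter_erase, hv]
        simp
  push Not at hS
  refine uniformRank_mask_of_forest hA _ _ fun R₀ _ C₀ hC₀ hne₀ => ?_
  by_contra! hcon
  simp only [filter_signedInc_ne_zero] at hcon
  let P : Finset {e // e ∈ H} × Finset (Fin n) → Prop := fun x =>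
    x.2 ⊆ S ∧ (x.1.Nonempty ∨ x.2.Nonempty) ∧
      x.1.card + x.2.card ≤ ∑ e ∈ x.1, (e.1 ∩ x.2).card
  obtain ⟨⟨R, T⟩, hmem, hmax⟩ := Finset.exists_max_image (Finset.univ.filter P)
    (fun x => x.1.card + x.2.card) ⟨(R₀, C₀), by simpa [P] using ⟨hC₀, hne₀, hcon⟩⟩
  simp only [Finset.mem_filter, Finset.mem_univ, true_and] at hmem hmax
  obtain ⟨hTS, hne, hexc⟩ := hmem
  simp only at hTS hne hexc
  have hR : ∀ e, (e.1 ∩ T).Nonempty → e ∈ R := by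
    intro e he
    by_contra heR
    have := hmax (insert e R, T) ⟨hTS, Or.inl (Finset.insert_nonempty _ _), by
      simp only
      rw [Finset.card_insert_of_notMem heR, Finset.sum_insert heR]
      have := he.card_pos
      omega⟩
    simp only [Finset.card_insert_of_notMem heR] at this
    omega
  have hT : ∀ e ∈ R, e.1 ∩ S ⊆ T := by
    intro e he u hu
    obtain ⟨hue, huS⟩ := Finset.mem_inter.1 hu
    by_contra huT
    have hlt : ∑ e ∈ R, (e.1 ∩ T).card < ∑ e ∈ R, (e.1 ∩ insert u T).card := by
      refine Finset.sum_lt_sum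
        (fun f _ => Finset.card_le_card
          (Finset.inter_subset_inter_left (Finset.subset_insert u T))) ⟨e, he, ?_⟩
      rw [Finset.inter_insert_of_mem hue, Finset.card_insert_of_notMem (by simp [huT])]
      exact Nat.lt_succ_self _
    have := hmax (R, insert u T) ⟨Finset.insert_subset huS hTS,
      Or.inr (Finset.insert_nonempty _ _), by
        simp only
        rw [Finset.card_insert_of_notMem huT]
        omega⟩
    simp only [Finset.card_insert_of_notMem huT] at this
    omega
  have hTne : T.Nonempty := by
    rw [Finset.nonempty_iff_ne_empty]
    rintro rfl
    simp at hexc hne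
    exact hne.ne_empty hexc
  refine h T hTS hTne ⟨fun e he hcard => hS e he ?_, ?_⟩
  · have heR := hR ⟨e, he⟩ (Finset.card_pos.1 (by simp only; omega))
    have : e ∩ S = e ∩ T := Finset.Subset.antisymm
      (Finset.subset_inter Finset.inter_subset_left (hT _ heR))
      (Finset.inter_subset_inter_left hTS)
    rw [this, hcard]
  · have h1 : ∑ e ∈ R, (e.1 ∩ T).card ≤ ∑ e ∈ R, ((e.1 ∩ T).card - 1) + R.card := by
      rw [Finset.card_eq_sum_ones, ← Finset.sum_add_distrib]
      exact Finset.sum_le_sum fun e _ => by omega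
    have h2 : ∑ e ∈ R, ((e.1 ∩ T).card - 1) ≤ ∑ e : {e // e ∈ H}, ((e.1 ∩ T).card - 1) :=
      Finset.sum_le_sum_of_subset (Finset.subset_univ R)
    rw [Finset.sum_coe_sort H (fun e => (e ∩ T).card - 1)] at h2
    omega

lemma sum_erWeight {α : Type*} (E : Finset α) (p : ℝ) :
    ∑ H ∈ E.powerset, p ^ H.card * (1 - p) ^ (E.card - H.card) = 1 := by
  have := sum_powerset_prod_weight E p (fun _ => 1)
  simpa using this

lemma erProb_le_one {n k : ℕ} {p : ℝ} (hp : p ∈ Set.Icc (0 : ℝ) 1)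
    (P : Finset (Finset (Fin n)) → Prop) : erProb n k p P ≤ 1 := by
  rw [← sum_erWeight (edgeSet n k) p]
  have hq : 0 ≤ 1 - p := by linarith [hp.2]
  exact Finset.sum_le_sum_of_subset_of_nonneg (Finset.filter_subset _ _)
    fun H _ _ => mul_nonneg (pow_nonneg hp.1 _) (pow_nonneg hq _)

/-- Union bound for the complement of `P`. -/
lemma one_sub_sum_erProb_le {ι : Type*} {n k : ℕ} {p : ℝ} (hp : p ∈ Set.Icc (0 : ℝ) 1)
    (P : Finset (Finset (Fin n)) → Prop) (F : Finset ι) (Q : ι → Finset (Finset (Fin n)) → Prop)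
    (h : ∀ H, ¬ P H → ∃ i ∈ F, Q i H) :
    1 - ∑ i ∈ F, erProb n k p (Q i) ≤ erProb n k p P := by
  rw [sub_le_iff_le_add, ← sum_erWeight (edgeSet n k) p]
  simp only [erProb, Finset.sum_filter]
  rw [Finset.sum_comm, ← Finset.sum_add_distrib]
  have hq : 0 ≤ 1 - p := by linarith [hp.2]
  refine Finset.sum_le_sum fun H _ => ?_
  have hc : 0 ≤ p ^ H.card * (1 - p) ^ ((edgeSet n k).card - H.card) :=
    mul_nonneg (pow_nonneg hp.1 _) (pow_nonneg hq _)
  have hnn : ∀ i ∈ F, 0 ≤ if Q i H then p ^ H.card * (1 - p) ^ ((edgeSet n k).card - H.card)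
      else 0 := fun i _ => by split_ifs <;> simp [hc]
  by_cases hP : P H
  · rw [if_pos hP]
    linarith [Finset.sum_nonneg hnn]
  · obtain ⟨i, hi, hQ⟩ := h H hP
    have := Finset.single_le_sum hnn hi
    rw [if_pos hQ] at this
    rw [if_neg hP]
    linarith

lemma choose_mul_pow_le {n m : ℕ} (hn : 0 < n) {x : ℝ} (hx : 0 ≤ x) :
    (n.choose m : ℝ) * (m * x / n) ^ m ≤ (Real.exp 1 * x) ^ m := by
  have h1 : (n.choose m : ℝ) ≤ (n : ℝ) ^ m / m.factorial := Nat.choose_le_pow_div m n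
  have h2 : (m : ℝ) ^ m / m.factorial ≤ Real.exp m :=
    Real.pow_div_factorial_le_exp _ (Nat.cast_nonneg m) m
  have hn0 : (0 : ℝ) < n := by exact_mod_cast hn
  calc (n.choose m : ℝ) * (m * x / n) ^ m
      ≤ (n : ℝ) ^ m / m.factorial * (m * x / n) ^ m := by gcongr
    _ = (m : ℝ) ^ m / m.factorial * x ^ m := by
        rw [div_pow, mul_pow]
        field_simp
    _ ≤ Real.exp m * x ^ m := by gcongr
    _ = _ := by rw [mul_pow, ← Real.exp_nat_mul, mul_one]

lemma sum_nonempty_pow_card_le {n : ℕ} (hn : 0 < n) {x : ℝ} (hx : 0 ≤ x)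
    (hx2 : Real.exp 1 * x ≤ 1 / 2) (F : Finset (Finset (Fin n))) (hF : ∀ T ∈ F, T.Nonempty) :
    ∑ T ∈ F, (T.card * x / n) ^ T.card ≤ 2 * (Real.exp 1 * x) := by
  set y := Real.exp 1 * x with hy
  have hy0 : 0 ≤ y := by positivity
  let f : ℕ → ℝ := fun m => if m = 0 then 0 else (m * x / n) ^ m
  have hf : ∀ m, 0 ≤ f m := fun m => by
    simp only [f]
    split_ifs <;> positivity
  calc ∑ T ∈ F, (T.card * x / n) ^ T.card = ∑ T ∈ F, f T.card := by
        refine Finset.sum_congr rfl fun T hT => ?_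
        simp only [f]
        rw [if_neg (hF T hT).card_pos.ne']
    _ ≤ ∑ T ∈ (Finset.univ : Finset (Fin n)).powerset, f T.card :=
        Finset.sum_le_sum_of_subset_of_nonneg (fun T _ => by simp) fun T _ _ => hf _
    _ = ∑ m ∈ Finset.range (n + 1), n.choose m • f m := by
        rw [Finset.sum_powerset_apply_card, Finset.card_univ, Fintype.card_fin]
    _ = ∑ m ∈ Finset.range n, (n.choose (m + 1) : ℝ) * ((m + 1 : ℕ) * x / n) ^ (m + 1) := by
        rw [Finset.sum_range_succ']
        simp [f]
    _ ≤ ∑ m ∈ Finset.range n, y * (1 / 2) ^ m := by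
        refine Finset.sum_le_sum fun m _ => (choose_mul_pow_le hn hx).trans ?_
        rw [pow_succ']
        gcongr
    _ = y * ∑ m ∈ Finset.range n, (1 / 2 : ℝ) ^ m := by rw [Finset.mul_sum]
    _ ≤ y * 2 := by
        gcongr
        exact sum_geometric_two_le n
    _ = 2 * y := mul_comm _ _

lemma pow_le_choose_of_card_lt {n s r : ℕ} {δ : ℝ} (hδ : δ < 1) (hs : (s : ℝ) < δ * n)
    (hn : 2 * r ≤ (1 - δ) * n) :
    ((1 - δ) / 2) ^ r / r.factorial * (n : ℝ) ^ r ≤ (n - s).choose r := by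
  have hn0 : (0 : ℝ) ≤ n := Nat.cast_nonneg n
  have hsn : s ≤ n := by
    have : (s : ℝ) ≤ n := by nlinarith
    exact_mod_cast this
  have h := Nat.pow_le_choose r (n - s) (α := ℝ)
  have hcast : (1 - δ) / 2 * n ≤ ((n - s + 1 - r : ℕ) : ℝ) := by
    have h1 : ((n - s : ℕ) : ℝ) + 1 ≤ ((n - s + 1 - r : ℕ) : ℝ) + r := by
      norm_cast
      omega
    rw [Nat.cast_sub hsn] at h1
    nlinarith
  have h2 : ((1 - δ) / 2 * n) ^ r ≤ ((n - s + 1 - r : ℕ) : ℝ) ^ r :=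
    pow_le_pow_left₀ (mul_nonneg (by linarith) hn0) hcast r
  rw [div_mul_eq_mul_div, ← mul_pow]
  rw [div_le_iff₀ (by positivity)]
  exact h2.trans ((div_le_iff₀ (by positivity)).1 h)

/-- For `k ≥ 3`, `δ ∈ (0,1)` and `p` with `n^(k-1)·p(n) → ∞`, a.a.s. for
every `S ⊆ [n]` with `|S| < δn` and every prime `q`, the rank over `ℚ` of the submatrix of
`M(H)ᵀ` on the columns indexed by `S` equals its rank over `ℤ/qℤ`. -/
theorem small_support_rank_eq (k : ℕ) (hk : 3 ≤ k) (δ : ℝ) (hδ0 : 0 < δ) (hδ1 : δ < 1)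
    (p : ℕ → ℝ) (hp : ∀ n, p n ∈ Set.Icc (0 : ℝ) 1)
    (hgrow : Tendsto (fun n : ℕ => (n : ℝ) ^ (k - 1) * p n) atTop atTop) :
    Tendsto (fun n => erProb n k (p n) (fun H =>
      ∀ S : Finset (Fin n), (S.card : ℝ) < δ * n → ∀ q : ℕ, q.Prime →
        (((signedInc H).transpose.submatrix id (fun j : {x // x ∈ S} => (j : Fin n))).map
            (Int.cast : ℤ → ℚ)).rank =
        (((signedInc H).transpose.submatrix id (fun j : {x // x ∈ S} => (j : Fin n))).map
            (Int.cast : ℤ → ZMod q)).rank))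
      atTop (nhds 1) := by
  set ω : ℕ → ℝ := fun n => (n : ℝ) ^ (k - 1) * p n with hω
  set c : ℝ := ((1 - δ) / 2) ^ (k - 1) / (k - 1).factorial with hc
  have hδ : 0 < 1 - δ := by linarith
  have hc0 : 0 < c := by positivity
  set x : ℕ → ℝ := fun n => ω n * Real.exp (k - c * ω n) with hx
  have hlim : Tendsto (fun n => Real.exp 1 * x n) atTop (nhds 0) := by
    have h1 := (tendsto_rpow_mul_exp_neg_mul_atTop_nhds_zero 1 c hc0).comp hgrow
    have h2 := h1.const_mul (Real.exp 1 * Real.exp k)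
    rw [mul_zero] at h2
    refine h2.congr fun n => ?_
    simp only [Function.comp_apply, Real.rpow_one, hx, hω]
    rw [sub_eq_add_neg, Real.exp_add, neg_mul]
    ring
  have hlow : Tendsto (fun n => 1 - 2 * (Real.exp 1 * x n)) atTop (nhds 1) := by
    simpa using (hlim.const_mul 2).const_sub 1
  refine tendsto_of_tendsto_of_tendsto_of_le_of_le' hlow tendsto_const_nhds ?_
    (Eventually.of_forall fun n => erProb_le_one (hp n) _)
  have hlarge : ∀ᶠ n : ℕ in atTop, 2 * ((k - 1 : ℕ) : ℝ) ≤ (1 - δ) * n :=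
    (tendsto_natCast_atTop_atTop.const_mul_atTop hδ).eventually_ge_atTop _
  filter_upwards [hgrow.eventually_ge_atTop 1,
    hlim.eventually_le_const (by norm_num : (0 : ℝ) < 1 / 2), hlarge, eventually_gt_atTop 0] with n hω1 hx2 hn hn0
  set F : Finset (Finset (Fin n)) :=
    Finset.univ.filter fun T => T.Nonempty ∧ (T.card : ℝ) < δ * n with hF
  have hx0 : 0 ≤ x n := mul_nonneg (by linarith) (Real.exp_pos _).le
  refine le_trans ?_ (one_sub_sum_erProb_le (hp n) _ F (fun T H => IsObstruction H T) ?_)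
  · have hbound : ∑ T ∈ F, erProb n k (p n) (fun H => IsObstruction H T) ≤
        ∑ T ∈ F, (T.card * x n / n) ^ T.card := by
      refine Finset.sum_le_sum fun T hT => ?_
      simp only [hF, Finset.mem_filter, Finset.mem_univ, true_and] at hT
      refine (erProb_isObstruction_le (by omega) (hp n) hn0 hω1 T hT.1
        (pow_le_choose_of_card_lt hδ1 hT.2 hn)).trans_eq ?_
      simp only [hx, hω, hc]
      ring
    have := sum_nonempty_pow_card_le hn0 hx0 hx2 F
      fun T hT => (Finset.mem_filter.1 hT).2.1
    linarith
  · intro H hH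
    by_contra! hno
    refine hH fun S hS q hq => ?_
    have : Fact q.Prime := ⟨hq⟩
    obtain ⟨r, hr⟩ := uniformRank_of_forall_not_isObstruction H S fun T hTS hT => hno T <| by
      simp only [hF, Finset.mem_filter, Finset.mem_univ, true_and]
      exact ⟨hT, lt_of_le_of_lt (by exact_mod_cast Finset.card_le_card hTS) hS⟩
    rw [rank_submatrix_eq_rank_mask, rank_submatrix_eq_rank_mask, hr ℚ, hr (ZMod q)]
end

section
/- Let k ≥ 3 be odd and δ > 0. For every sufficiently large constant c = c(k, δ) there exists a constant C = C(k, c, δ) > log(k) such that for all n, for every prime q, the probability that for H ~ H_k(n, cn) the kernel over ℤ/qℤ of M(H)^T contains a vector whose support has size at least δn is at most e^{-Cn}. -/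
open Finset Filter
open scoped Classical

/-- Probability that `H ~ H_k(n,m)` (uniform on `k`-uniform hypergraphs on `{1,...,n}` with
exactly `m` hyperedges) satisfies the predicate `P`. -/
noncomputable def uniProb (n k m : ℕ) (P : Finset (Finset (Fin n)) → Prop) : ℝ :=
  ((((edgeSet n k).powersetCard m).filter (fun H => P H)).card : ℝ) /
    (((edgeSet n k).powersetCard m).card : ℝ)

/-- Decreasing both the top of a binomial coefficient by a factor `θ` costs a factor `θ ^ j`. -/
theorem choose_le_pow_mul_choose {θ : ℝ} (hθ0 : 0 ≤ θ) (hθ1 : θ ≤ 1) {a b : ℕ}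
    (hab : (a : ℝ) ≤ θ * b) (j : ℕ) : (a.choose j : ℝ) ≤ θ ^ j * b.choose j := by
  induction j with
  | zero => simp
  | succ j ih =>
    have ha : (a.choose (j + 1) : ℝ) * (j + 1) = a.choose j * ((a - j : ℕ) : ℝ) := by
      exact_mod_cast Nat.choose_succ_right_eq a j
    have hb : (b.choose (j + 1) : ℝ) * (j + 1) = b.choose j * ((b - j : ℕ) : ℝ) := by
      exact_mod_cast Nat.choose_succ_right_eq b j
    have hsub : ((a - j : ℕ) : ℝ) ≤ θ * ((b - j : ℕ) : ℝ) := by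
      rcases le_total a j with h | h
      · rw [Nat.sub_eq_zero_of_le h]
        simpa using mul_nonneg hθ0 (Nat.cast_nonneg _)
      · have hab' : a ≤ b := by
          have : (a : ℝ) ≤ b := hab.trans (mul_le_of_le_one_left (Nat.cast_nonneg _) hθ1)
          exact_mod_cast this
        rw [Nat.cast_sub h, Nat.cast_sub (h.trans hab')]
        nlinarith [(Nat.cast_nonneg j : (0 : ℝ) ≤ j)]
    have hj : (0 : ℝ) < j + 1 := by positivity
    refine le_of_mul_le_mul_right ?_ hj
    calc (a.choose (j + 1) : ℝ) * (j + 1) = a.choose j * ((a - j : ℕ) : ℝ) := ha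
      _ ≤ (θ ^ j * b.choose j) * (θ * ((b - j : ℕ) : ℝ)) := by gcongr
      _ = θ ^ (j + 1) * (b.choose j * ((b - j : ℕ) : ℝ)) := by ring
      _ = θ ^ (j + 1) * b.choose (j + 1) * (j + 1) := by rw [← hb]; ring

/-- If every set of a family of `m`-subsets of `E` is contained in the closure `Z S`, of size at
most `θ * #E`, of one of its subsets `S` of size at most `n`, then the family is small. -/
theorem card_le_of_small_generators {α : Type*} [DecidableEq α] {E : Finset α} {m n : ℕ} {θ : ℝ}
    (hθ0 : 0 ≤ θ) (hθ1 : θ ≤ 1) (Z : Finset α → Finset α) {B : Finset (Finset α)}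
    (hB : B ⊆ E.powersetCard m)
    (hgen : ∀ H ∈ B, ∃ S ⊆ H, S.card ≤ n ∧ H ⊆ Z S ∧ Z S ⊆ E ∧ ((Z S).card : ℝ) ≤ θ * E.card)
    (hnm : n ≤ m) :
    (B.card : ℝ) ≤
      E.card.choose m * (θ ^ (m - n) * ∑ s ∈ Finset.range (n + 1), (m.choose s : ℝ)) := by
  classical
  let G : ℕ → Finset (Finset α) := fun s => (E.powersetCard s).filter
    (fun S => S ⊆ Z S ∧ Z S ⊆ E ∧ ((Z S).card : ℝ) ≤ θ * E.card)
  have hcover : B ⊆ (Finset.range (n + 1)).biUnion fun s => (G s).biUnion fun S =>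
      ((Z S \ S).powersetCard (m - s)).image (fun R => S ∪ R) := by
    intro H hH
    obtain ⟨S, hSH, hSn, hHZ, hZE, hZ⟩ := hgen H hH
    obtain ⟨hHE, hHm⟩ := Finset.mem_powersetCard.1 (hB hH)
    refine Finset.mem_biUnion.2 ⟨S.card, Finset.mem_range.2 (by omega), Finset.mem_biUnion.2
      ⟨S, ?_, Finset.mem_image.2 ⟨H \ S, ?_, Finset.union_sdiff_of_subset hSH⟩⟩⟩
    · exact Finset.mem_filter.2 ⟨Finset.mem_powersetCard.2 ⟨hSH.trans hHE, rfl⟩,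
        hSH.trans hHZ, hZE, hZ⟩
    · exact Finset.mem_powersetCard.2 ⟨Finset.sdiff_subset_sdiff hHZ subset_rfl, by
        rw [Finset.card_sdiff_of_subset hSH, hHm]⟩
  have hterm : ∀ s ∈ Finset.range (n + 1), ∀ S ∈ G s,
      (((((Z S \ S).powersetCard (m - s)).image (fun R => S ∪ R)).card : ℕ) : ℝ) ≤
        θ ^ (m - n) * ((E.card - s).choose (m - s) : ℝ) := by
    intro s hs S hS
    obtain ⟨hSs, hSZ, hZE, hZ⟩ := Finset.mem_filter.1 hS
    obtain ⟨hSE, rfl⟩ := Finset.mem_powersetCard.1 hSs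
    have hs' : S.card ≤ n := by simpa [Nat.lt_succ_iff] using hs
    have hcard : ((Z S \ S).card : ℝ) ≤ θ * ((E.card - S.card : ℕ) : ℝ) := by
      rw [Finset.card_sdiff_of_subset hSZ, Nat.cast_sub (Finset.card_le_card hSZ),
        Nat.cast_sub (Finset.card_le_card hSE)]
      nlinarith [(Nat.cast_nonneg S.card : (0 : ℝ) ≤ S.card)]
    calc ((((Z S \ S).powersetCard (m - S.card)).image (fun R => S ∪ R)).card : ℝ)
        ≤ ((Z S \ S).card.choose (m - S.card) : ℝ) := by
          rw [← Finset.card_powersetCard]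
          exact_mod_cast Finset.card_image_le
      _ ≤ θ ^ (m - S.card) * ((E.card - S.card).choose (m - S.card) : ℝ) :=
          choose_le_pow_mul_choose hθ0 hθ1 hcard _
      _ ≤ θ ^ (m - n) * ((E.card - S.card).choose (m - S.card) : ℝ) := by
          gcongr ?_ * _
          exact pow_le_pow_of_le_one hθ0 hθ1 (by omega)
  rcases lt_or_ge E.card m with hEm | hEm
  · have : B = ∅ := Finset.subset_empty.1 (by rwa [Finset.powersetCard_eq_empty.2 hEm] at hB)
    rw [this, Finset.card_empty, Nat.cast_zero]
    positivity
  calc (B.card : ℝ)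
      ≤ ∑ s ∈ Finset.range (n + 1), ∑ S ∈ G s,
          ((((Z S \ S).powersetCard (m - s)).image (fun R => S ∪ R)).card : ℝ) := by
        have := (Finset.card_le_card hcover).trans (Finset.card_biUnion_le.trans
          (Finset.sum_le_sum fun s _ => Finset.card_biUnion_le))
        exact_mod_cast this
    _ ≤ ∑ s ∈ Finset.range (n + 1), ∑ S ∈ G s,
          θ ^ (m - n) * ((E.card - s).choose (m - s) : ℝ) :=
        Finset.sum_le_sum fun s hs => Finset.sum_le_sum fun S hS => hterm s hs S hS
    _ ≤ ∑ s ∈ Finset.range (n + 1),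
          (E.card.choose s : ℝ) * (θ ^ (m - n) * ((E.card - s).choose (m - s) : ℝ)) := by
        refine Finset.sum_le_sum fun s _ => ?_
        rw [Finset.sum_const, nsmul_eq_mul]
        gcongr
        rw [← Finset.card_powersetCard]
        exact Finset.card_filter_le _ _
    _ = E.card.choose m * (θ ^ (m - n) * ∑ s ∈ Finset.range (n + 1), (m.choose s : ℝ)) := by
        rw [Finset.mul_sum, Finset.mul_sum]
        refine Finset.sum_congr rfl fun s hs => ?_
        have hs' : s ≤ m := by have := Finset.mem_range.1 hs; omega
        have : (E.card.choose m : ℝ) * m.choose s =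
            E.card.choose s * (E.card - s).choose (m - s) := by
          exact_mod_cast Nat.choose_mul hs'
        linear_combination (-θ ^ (m - n)) * this

/-- The first `n + 1` binomial coefficients of `c * n` sum to at most `(e * c) ^ n`. -/
theorem sum_range_choose_mul_le {c : ℕ} (hc : 1 ≤ c) (n : ℕ) :
    ∑ s ∈ Finset.range (n + 1), ((c * n).choose s : ℝ) ≤ (Real.exp 1 * c) ^ n := by
  have hc0 : (0 : ℝ) < c := by exact_mod_cast hc
  have hc1 : (1 : ℝ) ≤ c := by exact_mod_cast hc
  calc ∑ s ∈ Finset.range (n + 1), ((c * n).choose s : ℝ)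
      ≤ ∑ s ∈ Finset.range (n + 1), (c : ℝ) ^ n * ((1 / c : ℝ) ^ s * (c * n).choose s) := by
        refine Finset.sum_le_sum fun s hs => ?_
        have hs' : s ≤ n := Nat.lt_succ_iff.1 (Finset.mem_range.1 hs)
        have : (1 : ℝ) ≤ (c : ℝ) ^ n * (1 / c : ℝ) ^ s := by
          rw [one_div, inv_pow, ← div_eq_mul_inv, one_le_div (by positivity)]
          exact pow_le_pow_right₀ hc1 hs'
        rw [← mul_assoc]
        exact le_mul_of_one_le_left (Nat.cast_nonneg _) this
    _ ≤ ∑ s ∈ Finset.range (c * n + 1), (c : ℝ) ^ n * ((1 / c : ℝ) ^ s * (c * n).choose s) := by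
        refine Finset.sum_le_sum_of_subset_of_nonneg ?_ fun _ _ _ => by positivity
        exact Finset.range_subset_range.2 (by nlinarith)
    _ = (c : ℝ) ^ n * (1 / c + 1) ^ (c * n) := by
        rw [← Finset.mul_sum, add_pow]
        simp
    _ ≤ (c : ℝ) ^ n * Real.exp (1 / c) ^ (c * n) := by
        gcongr
        exact Real.add_one_le_exp _
    _ = (Real.exp 1 * c) ^ n := by
        rw [pow_mul, ← Real.exp_nat_mul, mul_one_div_cancel hc0.ne', mul_pow, mul_comm]

/-- The row of the incidence matrix of `e`, with entries in `R`. -/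
def edgeVec (R : Type*) [Ring R] {n : ℕ} (e : Finset (Fin n)) : Fin n → R :=
  fun u => if u ∈ e then (-1 : R) ^ (e.filter (fun x => x < u)).card else 0

theorem edgeVec_dotProduct {R : Type*} [Ring R] {n : ℕ} (e : Finset (Fin n)) (v : Fin n → R) :
    edgeVec R e ⬝ᵥ v = ∑ u ∈ e, (-1 : R) ^ (e.filter (fun x => x < u)).card * v u := by
  simp [edgeVec, dotProduct, ite_mul, Finset.sum_ite_mem]

theorem signedInc_mulVec_eq_zero_iff {R : Type*} [Ring R] {n : ℕ} (H : Finset (Finset (Fin n)))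
    (v : Fin n → R) :
    Matrix.mulVec (((signedInc H).transpose).map (Int.cast : ℤ → R)) v = 0 ↔
      ∀ e ∈ H, edgeVec R e ⬝ᵥ v = 0 := by
  have hrow : ∀ e : {e // e ∈ H},
      ((signedInc H).transpose).map (Int.cast : ℤ → R) e = edgeVec R e.1 := by
    intro e
    funext u
    simp only [Matrix.map_apply, Matrix.transpose_apply, signedInc, edgeVec]
    split_ifs <;> simp
  constructor
  · intro h e he
    have := congrFun h ⟨e, he⟩
    rwa [Matrix.mulVec, hrow] at this
  · intro h
    funext e
    rw [Matrix.mulVec, hrow]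
    exact h e.1 e.2

/-- Some row-space basis among the edges of `H` already cuts out the kernel. -/
theorem exists_small_generators {F : Type*} [Field F] {n : ℕ} (H : Finset (Finset (Fin n))) :
    ∃ S ⊆ H, S.card ≤ n ∧ ∀ v : Fin n → F,
      (∀ e ∈ S, edgeVec F e ⬝ᵥ v = 0) → ∀ e ∈ H, edgeVec F e ⬝ᵥ v = 0 := by
  obtain ⟨b, hbH, -, hspan, hli⟩ := exists_linearIndepOn_extension
    (linearIndepOn_empty F (edgeVec F (n := n))) (Set.empty_subset (H : Set (Finset (Fin n))))
  lift b to Finset (Finset (Fin n)) using H.finite_toSet.subset hbH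
  refine ⟨b, by exact_mod_cast hbH, ?_, fun v hv e he => ?_⟩
  · have := LinearIndependent.fintype_card_le_finrank hli
    simpa using this
  · have hmem := hspan (Set.mem_image_of_mem _ (Finset.mem_coe.2 he))
    generalize edgeVec F e = x at hmem
    induction hmem using Submodule.span_induction with
    | mem x hx =>
      obtain ⟨e', he', rfl⟩ := hx
      exact hv e' he'
    | zero => exact zero_dotProduct v
    | add x y _ _ hx hy => rw [add_dotProduct, hx, hy, add_zero]
    | smul a x _ hx => rw [smul_dotProduct, hx, smul_zero]

/-- If removing any one position from a sequence of even length leaves a vanishing alternating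
sum, then the sequence vanishes. -/
theorem eq_zero_of_alternating_erase {R : Type*} [Ring R] {k : ℕ} (hodd : Odd k) (w : ℕ → R)
    (h : ∀ j ≤ k, ∑ i ∈ Finset.range j, (-1 : R) ^ i * w i =
      ∑ i ∈ Finset.Ico (j + 1) (k + 1), (-1 : R) ^ i * w i) :
    ∀ j ≤ k, w j = 0 := by
  have hstep : ∀ j < k, w (j + 1) = w j := by
    intro j hj
    have h0 := h j hj.le
    have h1 := h (j + 1) hj
    rw [Finset.sum_range_succ] at h1
    rw [Finset.sum_eq_sum_Ico_succ_bot (by omega)] at h0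
    have h2 : (-1 : R) ^ j * w (j + 1) = (-1) ^ j * w j := by
      rw [h0, pow_succ] at h1
      have : (-1 : R) ^ j * -1 * w (j + 1) + (-1 : R) ^ j * w j = 0 := by
        rw [← sub_eq_zero] at h1
        rw [← h1]
        abel
      rw [mul_neg_one, neg_mul] at this
      exact neg_add_eq_zero.1 this
    exact ((isUnit_one.neg).pow j).mul_left_cancel h2
  have hconst : ∀ j ≤ k, w j = w 0 := by
    intro j
    induction j with
    | zero => simp
    | succ j ih => exact fun hj => (hstep j hj).trans (ih (by omega))
  have hzero : w 0 = 0 := by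
    have h0 := h 0 (Nat.zero_le _)
    rw [Finset.sum_range_zero,
      Finset.sum_congr rfl (g := fun i => (-1 : R) ^ i * w 0) (fun i hi => by
      rw [hconst i (by have := Finset.mem_Ico.1 hi; omega)])] at h0
    have h1 : ∑ i ∈ Finset.range (k + 1), (-1 : R) ^ i * w 0 = 0 := by
      rw [← Finset.sum_mul, neg_one_geom_sum, if_pos hodd.add_one, zero_mul]
    rw [Finset.range_eq_Ico, Finset.sum_eq_sum_Ico_succ_bot (by omega)] at h1
    rw [← h0] at h1
    simpa using h1
  exact fun j hj => (hconst j hj).trans hzero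

/-- A `(k+1)`-set meeting the support of `v` contains a `k`-set with nonzero signed sum. -/
theorem eq_zero_of_erase_dotProduct {R : Type*} [Ring R] {n k : ℕ} (hodd : Odd k)
    {f : Finset (Fin n)} (hf : f.card = k + 1) (v : Fin n → R)
    (h : ∀ x ∈ f, edgeVec R (f.erase x) ⬝ᵥ v = 0) : ∀ u ∈ f, v u = 0 := by
  let φ := f.orderEmbOfFin hf
  have hmap : Finset.univ.map φ.toEmbedding = f := Finset.map_orderEmbOfFin_univ f hf
  let w : ℕ → R := fun i => if hi : i < k + 1 then v (φ ⟨i, hi⟩) else 0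
  have hw : ∀ i : Fin (k + 1), w i = v (φ i) := fun i => dif_pos i.2
  have herase : ∀ j : Fin (k + 1), f.erase (φ j) = (Finset.univ.erase j).map φ.toEmbedding := by
    intro j
    rw [Finset.map_erase, hmap]
    rfl
  have hsum : ∀ j : Fin (k + 1), edgeVec R (f.erase (φ j)) ⬝ᵥ v =
      ∑ i ∈ Finset.univ.erase j,
        (if i < j then (-1 : R) ^ (i : ℕ) * w i else -((-1 : R) ^ (i : ℕ) * w i)) := by
    intro j
    rw [edgeVec_dotProduct, herase, Finset.sum_map]
    refine Finset.sum_congr rfl fun i hi => ?_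
    have hij : i ≠ j := Finset.ne_of_mem_erase hi
    have hcard : (((Finset.univ.erase j).map φ.toEmbedding).filter
        (fun x => x < φ.toEmbedding i)).card = ((Finset.Iio i).erase j).card := by
      rw [Finset.filter_map, Finset.card_map]
      congr 1
      ext x
      simp
    rw [hcard, Finset.card_erase_eq_ite, Fin.card_Iio, hw]
    rcases lt_or_gt_of_ne hij with hlt | hgt
    · rw [if_neg (by simpa using hlt.le), if_pos hlt]
      rfl
    · rw [if_pos (by simpa using hgt), if_neg (not_lt.2 hgt.le)]
      obtain ⟨i', hi'⟩ : ∃ i', (i : ℕ) = i' + 1 := ⟨i - 1, by have : (j : ℕ) < i := hgt; omega⟩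
      rw [hi', Nat.add_sub_cancel, pow_succ, mul_neg_one, neg_mul, neg_neg]
      rfl
  have hzero : ∀ j ≤ k, w j = 0 := by
    refine eq_zero_of_alternating_erase hodd w fun j hj => ?_
    have hj' : j < k + 1 := by omega
    have h0 := h (φ ⟨j, hj'⟩) (Finset.orderEmbOfFin_mem f hf _)
    rw [hsum] at h0
    have h1 : ∑ i : Fin (k + 1), (if (i : ℕ) < j then (-1 : R) ^ (i : ℕ) * w i
        else if j < (i : ℕ) then -((-1 : R) ^ (i : ℕ) * w i) else 0) = 0 := by
      refine Eq.trans ?_ h0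
      rw [← Finset.sum_erase_add _ _ (Finset.mem_univ (⟨j, hj'⟩ : Fin (k + 1)))]
      simp only [lt_irrefl, if_false, add_zero]
      refine Finset.sum_congr rfl fun i hi => ?_
      have hij : (i : ℕ) ≠ j := fun hh => Finset.ne_of_mem_erase hi (Fin.ext hh)
      by_cases hlt : (i : ℕ) < j
      · rw [if_pos hlt, if_pos (Fin.lt_def.2 hlt)]
      · rw [if_neg hlt, if_neg (fun hh => hlt (Fin.lt_def.1 hh)), if_pos (by omega)]
    rw [Fin.sum_univ_eq_sum_range (fun i : ℕ => if i < j then (-1 : R) ^ i * w i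
        else if j < i then -((-1 : R) ^ i * w i) else 0), Finset.range_eq_Ico,
      ← Finset.sum_Ico_consecutive _ (Nat.zero_le j) hj'.le,
      Finset.sum_eq_sum_Ico_succ_bot hj',
      Finset.sum_congr rfl (g := fun i => (-1 : R) ^ i * w i)
        (fun i hi => if_pos (Finset.mem_Ico.1 hi).2),
      Finset.sum_congr (s₁ := Finset.Ico (j + 1) (k + 1)) rfl
        (g := fun i => -((-1 : R) ^ i * w i)) (fun i hi => by
          have := Finset.mem_Ico.1 hi
          rw [if_neg (by omega), if_pos (by omega)])] at h1
    simp only [lt_irrefl, if_false, zero_add, Finset.sum_neg_distrib] at h1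
    rw [Finset.range_eq_Ico]
    exact add_neg_eq_zero.1 h1
  intro u hu
  rw [← hmap] at hu
  obtain ⟨i, -, rfl⟩ := Finset.mem_map.1 hu
  have := hzero i (by omega)
  rwa [hw] at this

/-- A vector with support of size `t` has nonzero signed sum on at least a fraction
`t / (n * (k + 1))` of all `k`-sets. -/
theorem support_mul_choose_le {R : Type*} [Ring R] [DecidableEq R] {n k : ℕ}
    (hodd : Odd k) (hkn : k < n)
    (v : Fin n → R) :
    (Finset.univ.filter (fun i => v i ≠ 0)).card * n.choose k ≤
      ((edgeSet n k).filter (fun e => edgeVec R e ⬝ᵥ v ≠ 0)).card * ((k + 1) * n) := by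
  set T := Finset.univ.filter (fun i => v i ≠ 0) with hT
  set B := (edgeSet n k).filter (fun e => edgeVec R e ⬝ᵥ v ≠ 0) with hB
  let U : Finset (Finset (Fin n)) := B.biUnion fun e => eᶜ.image fun x => insert x e
  have hBk : ∀ e ∈ B, e.card = k := fun e he =>
    (Finset.mem_powersetCard.1 (Finset.mem_filter.1 he).1).2
  have hUcard : U.card ≤ B.card * (n - k) := by
    refine Finset.card_biUnion_le_card_mul _ _ _ fun e he => Finset.card_image_le.trans ?_
    rw [Finset.card_compl, Fintype.card_fin, hBk e he]
  have hUk : ∀ f ∈ U, f.card = k + 1 := by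
    intro f hf
    obtain ⟨e, he, hf⟩ := Finset.mem_biUnion.1 hf
    obtain ⟨x, hx, rfl⟩ := Finset.mem_image.1 hf
    rw [Finset.card_insert_of_notMem (Finset.mem_compl.1 hx), hBk e he]
  have hUmem : ∀ u ∈ T, ∀ g ∈ (Finset.univ.erase u).powersetCard k, insert u g ∈ U := by
    intro u hu g hg
    obtain ⟨hgu, hgk⟩ := Finset.mem_powersetCard.1 hg
    have hug : u ∉ g := fun hh => Finset.notMem_erase u _ (hgu hh)
    have hcard : (insert u g).card = k + 1 := by rw [Finset.card_insert_of_notMem hug, hgk]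
    by_contra hnot
    refine (Finset.mem_filter.1 hu).2
      (eq_zero_of_erase_dotProduct hodd hcard v (fun x hx => ?_) u (Finset.mem_insert_self u g))
    by_contra hne
    refine hnot (Finset.mem_biUnion.2 ⟨(insert u g).erase x, Finset.mem_filter.2
      ⟨Finset.mem_powersetCard.2 ⟨Finset.subset_univ _, ?_⟩, hne⟩, Finset.mem_image.2
      ⟨x, Finset.mem_compl.2 (Finset.notMem_erase x _), Finset.insert_erase hx⟩⟩)
    rw [Finset.card_erase_of_mem hx, hcard, Nat.add_sub_cancel]
  have hdouble : T.card * (n - 1).choose k ≤ U.card * (k + 1) := by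
    refine Finset.card_mul_le_card_mul (fun u f => u ∈ f) (fun u hu => ?_) (fun f hf => ?_)
    · calc (n - 1).choose k = ((Finset.univ.erase u).powersetCard k).card := by
            rw [Finset.card_powersetCard, Finset.card_erase_of_mem (Finset.mem_univ u),
              Finset.card_univ, Fintype.card_fin]
        _ ≤ _ := by
            refine Finset.card_le_card_of_injOn (fun g => insert u g) (fun g hg => ?_) ?_
            · exact Finset.mem_coe.2 (Finset.mem_filter.2
                ⟨hUmem u hu g hg, Finset.mem_insert_self u g⟩)
            · intro g hg g' hg' hgg
              have hng : ∀ g ∈ (Finset.univ.erase u).powersetCard k, u ∉ g := fun g hg hh =>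
                Finset.notMem_erase u _ ((Finset.mem_powersetCard.1 hg).1 hh)
              have := congrArg (fun s => Finset.erase s u) hgg
              simpa [Finset.erase_insert (hng g hg), Finset.erase_insert (hng g' hg')] using this
    · rw [← hUk f hf]
      exact Finset.card_le_card fun u hu => (Finset.mem_filter.1 hu).2
  have hchoose : n * (n - 1).choose k = n.choose k * (n - k) := by
    obtain ⟨n', rfl⟩ : ∃ n', n = n' + 1 := ⟨n - 1, by omega⟩
    rw [Nat.add_sub_cancel, Nat.add_one_mul_choose_eq, Nat.choose_succ_right_eq]
  refine Nat.le_of_mul_le_mul_right (c := n - k) ?_ (by omega)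
  calc T.card * n.choose k * (n - k) = n * (T.card * (n - 1).choose k) := by
        rw [mul_assoc, ← hchoose]; ring
    _ ≤ n * (U.card * (k + 1)) := by gcongr
    _ ≤ n * (B.card * (n - k) * (k + 1)) := by
        gcongr
    _ = B.card * ((k + 1) * n) * (n - k) := by ring

/-- The proportion of hypergraphs whose kernel has a vector of large support. -/
theorem uniProb_large_support_le {F : Type*} [Field F] [DecidableEq F] {k c n : ℕ}
    (hodd : Odd k) (hc : 1 ≤ c)
    (hkn : k < n) {δ : ℝ} (hδ0 : 0 < δ) (hδ1 : δ ≤ 1) :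
    uniProb n k (c * n) (fun H => ∃ v : Fin n → F,
        Matrix.mulVec (((signedInc H).transpose).map (Int.cast : ℤ → F)) v = 0 ∧
        δ * n ≤ ((Finset.univ.filter (fun i => v i ≠ 0)).card : ℝ)) ≤
      (Real.exp 1 * c * (1 - δ / (k + 1)) ^ (c - 1)) ^ n := by
  set θ : ℝ := 1 - δ / (k + 1) with hθ
  have hθ0 : 0 ≤ θ := by
    have : δ / (k + 1) ≤ 1 := (div_le_one (by positivity)).2 (by
      linarith [(Nat.cast_nonneg k : (0 : ℝ) ≤ k)])
    linarith
  have hθ1 : θ ≤ 1 := by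
    have : 0 ≤ δ / (k + 1) := by positivity
    linarith
  have hn : (0 : ℝ) < n := by exact_mod_cast (by omega : 0 < n)
  let Z : Finset (Finset (Fin n)) → Finset (Finset (Fin n)) := fun S =>
    (edgeSet n k).filter fun e => ∀ v : Fin n → F,
      (∀ e' ∈ S, edgeVec F e' ⬝ᵥ v = 0) → edgeVec F e ⬝ᵥ v = 0
  have hE : (edgeSet n k).card = n.choose k := by
    rw [edgeSet, Finset.card_powersetCard, Finset.card_univ, Fintype.card_fin]
  have hcount := card_le_of_small_generators (n := n) hθ0 hθ1 Z
    (Finset.filter_subset (fun H => ∃ v : Fin n → F,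
        Matrix.mulVec (((signedInc H).transpose).map (Int.cast : ℤ → F)) v = 0 ∧
        δ * n ≤ ((Finset.univ.filter (fun i => v i ≠ 0)).card : ℝ))
      ((edgeSet n k).powersetCard (c * n))) (fun H hH => by
    obtain ⟨hHm, v, hv, hsupp⟩ := Finset.mem_filter.1 hH
    obtain ⟨hHE, -⟩ := Finset.mem_powersetCard.1 hHm
    rw [signedInc_mulVec_eq_zero_iff] at hv
    obtain ⟨S, hSH, hSn, hS⟩ := exists_small_generators (F := F) H
    refine ⟨S, hSH, hSn, fun e he => Finset.mem_filter.2 ⟨hHE he, fun v hv => hS v hv e he⟩,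
      Finset.filter_subset _ _, ?_⟩
    have hnonzero := support_mul_choose_le hodd hkn v
    have hZ : (Z S).card + ((edgeSet n k).filter (fun e => edgeVec F e ⬝ᵥ v ≠ 0)).card ≤
        (edgeSet n k).card := by
      rw [← Finset.card_filter_add_card_filter_not (s := edgeSet n k)
        (fun e => edgeVec F e ⬝ᵥ v = 0)]
      refine Nat.add_le_add_right (Finset.card_le_card fun e he => ?_) _
      obtain ⟨he, hev⟩ := Finset.mem_filter.1 he
      exact Finset.mem_filter.2 ⟨he, hev v fun e' he' => hv e' (hSH he')⟩
    have hlarge : δ / (k + 1) * (edgeSet n k).card ≤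
        ((edgeSet n k).filter (fun e => edgeVec F e ⬝ᵥ v ≠ 0)).card := by
      have h1 : ((Finset.univ.filter (fun i => v i ≠ 0)).card : ℝ) * n.choose k ≤
          ((edgeSet n k).filter (fun e => edgeVec F e ⬝ᵥ v ≠ 0)).card * ((k + 1) * n) := by
        exact_mod_cast hnonzero
      have h2 : δ * n * n.choose k ≤
          ((edgeSet n k).filter (fun e => edgeVec F e ⬝ᵥ v ≠ 0)).card * ((k + 1) * n) :=
        (mul_le_mul_of_nonneg_right hsupp (Nat.cast_nonneg _)).trans h1
      rw [hE, div_mul_eq_mul_div, div_le_iff₀ (by positivity)]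
      refine le_of_mul_le_mul_right ?_ hn
      linarith
    have hZ' : ((Z S).card : ℝ) +
        ((edgeSet n k).filter (fun e => edgeVec F e ⬝ᵥ v ≠ 0)).card ≤ (edgeSet n k).card := by
      exact_mod_cast hZ
    rw [hθ, sub_mul, one_mul]
    linarith) (Nat.le_mul_of_pos_left n hc)
  rw [uniProb]
  refine div_le_of_le_mul₀ (Nat.cast_nonneg _) (by positivity) (hcount.trans ?_)
  rw [Finset.card_powersetCard, mul_comm]
  gcongr
  calc θ ^ (c * n - n) * ∑ s ∈ Finset.range (n + 1), ((c * n).choose s : ℝ)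
      ≤ θ ^ (c * n - n) * (Real.exp 1 * c) ^ n := by
        gcongr
        exact sum_range_choose_mul_le hc n
    _ = (Real.exp 1 * c * θ ^ (c - 1)) ^ n := by
        rw [mul_pow (Real.exp 1 * c), ← pow_mul, Nat.sub_mul, one_mul, mul_comm]

theorem eventually_mul_pow_pred_le {θ : ℝ} (hθ0 : 0 < θ) (hθ1 : θ < 1) {A ε : ℝ} (hε : 0 < ε) :
    ∃ c₀ : ℕ, ∀ c : ℕ, c₀ ≤ c → A * c * θ ^ (c - 1) ≤ ε := by
  have hlim : Tendsto (fun c : ℕ => A / θ * (c * θ ^ c)) atTop (nhds (A / θ * 0)) :=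
    (tendsto_self_mul_const_pow_of_lt_one hθ0.le hθ1).const_mul _
  rw [mul_zero] at hlim
  obtain ⟨c₀, hc₀⟩ := eventually_atTop.1 (hlim.eventually_le_const hε)
  refine ⟨c₀ + 1, fun c hc => ?_⟩
  obtain ⟨d, rfl⟩ : ∃ d, c = d + 1 := ⟨c - 1, by omega⟩
  refine le_trans (le_of_eq ?_) (hc₀ (d + 1) (by omega))
  rw [Nat.add_sub_cancel, pow_succ]
  field_simp

/-- For `k ≥ 3` odd and `δ > 0`, for every sufficiently large constant `c`
there is `C > log k` such that for all `n` and every prime `q`, the probability that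
`ker_{ℤ/qℤ}(M(H)ᵀ)` for `H ~ H_k(n, cn)` contains a vector of support size at least `δn` is
at most `e^{-Cn}`. -/
theorem large_support_kernel_odd (k : ℕ) (hk : 3 ≤ k) (hodd : Odd k) (δ : ℝ) (hδ : 0 < δ) :
    ∃ c₀ : ℕ, ∀ c : ℕ, c₀ ≤ c → ∃ C : ℝ, Real.log k < C ∧
      ∀ n q : ℕ, q.Prime →
        uniProb n k (c * n) (fun H => ∃ v : Fin n → ZMod q,
            Matrix.mulVec (((signedInc H).transpose).map (Int.cast : ℤ → ZMod q)) v = 0 ∧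
            δ * n ≤ ((Finset.univ.filter (fun i => v i ≠ 0)).card : ℝ)) ≤
          Real.exp (-C * n) := by
  set δ' : ℝ := min δ 1 with hδ'
  have hδ0 : 0 < δ' := lt_min hδ one_pos
  have hδ1 : δ' ≤ 1 := min_le_right _ _
  have hpos : 0 < δ' / (k + 1) := by positivity
  have hlt : δ' / (k + 1) < 1 := (div_lt_one (by positivity)).2 (by
    have : (3 : ℝ) ≤ k := by exact_mod_cast hk
    linarith)
  obtain ⟨c₀, hc₀⟩ := eventually_mul_pow_pred_le (sub_pos.2 hlt) (sub_lt_self 1 hpos)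
    (A := Real.exp 1) (Real.exp_pos (-(Real.log k + 1)))
  refine ⟨c₀ + 2, fun c hc => ⟨Real.log k + 1, by linarith, fun n q hq => ?_⟩⟩
  have : Fact q.Prime := ⟨hq⟩
  rcases Nat.eq_zero_or_pos n with rfl | hn
  · simp only [CharP.cast_eq_zero, mul_zero, Real.exp_zero]
    rw [uniProb]
    refine div_le_one_of_le₀ ?_ (Nat.cast_nonneg _)
    exact_mod_cast Finset.card_filter_le _ _
  rcases le_or_gt n k with hnk | hkn
  · have hsmall : (edgeSet n k).card < c * n := by
      rw [edgeSet, Finset.card_powersetCard, Finset.card_univ, Fintype.card_fin]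
      have : n.choose k ≤ 1 := by
        rcases hnk.lt_or_eq with h | rfl
        · simp [Nat.choose_eq_zero_of_lt h]
        · simp
      nlinarith
    rw [uniProb, Finset.powersetCard_eq_empty.2 hsmall]
    simpa using (Real.exp_pos _).le
  calc _ ≤ uniProb n k (c * n) (fun H => ∃ v : Fin n → ZMod q,
            Matrix.mulVec (((signedInc H).transpose).map (Int.cast : ℤ → ZMod q)) v = 0 ∧
            δ' * n ≤ ((Finset.univ.filter (fun i => v i ≠ 0)).card : ℝ)) := by
        rw [uniProb, uniProb]
        gcongr
        exact min_le_left _ _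
    _ ≤ (Real.exp 1 * c * (1 - δ' / (k + 1)) ^ (c - 1)) ^ n :=
        uniProb_large_support_le hodd (by omega) hkn hδ0 hδ1
    _ ≤ Real.exp (-(Real.log k + 1)) ^ n := by
        have := sub_pos.2 hlt
        gcongr
        exact hc₀ c (by omega)
    _ = Real.exp (-(Real.log k + 1) * n) := by rw [← Real.exp_nat_mul, mul_comm]
end

section
/- Let M be an integer matrix with n rows such that every column of M has Euclidean norm at most t, where t ≥ 1. Then the torsion subgroup of the cokernel of M is finite of order at most t^n. -/
/-- **Hadamard's inequality**: the absolute value of the determinant of a real square matrix is at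
most the product of the Euclidean norms of its rows. -/
theorem Matrix.abs_det_le_prod_sqrt_sum_sq {n : ℕ} (A : Matrix (Fin n) (Fin n) ℝ) :
    |A.det| ≤ ∏ i, Real.sqrt (∑ j, A i j ^ 2) := by
  have : Fact (Module.finrank ℝ (EuclideanSpace ℝ (Fin n)) = n) := ⟨by simp⟩
  let b := EuclideanSpace.basisFun (Fin n) ℝ
  let v : Fin n → EuclideanSpace ℝ (Fin n) := fun i => WithLp.toLp 2 (A i)
  have hdet : b.toBasis.det v = A.det := by
    rw [Module.Basis.det_apply, ← Matrix.det_transpose]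
    congr 1
  have h := b.toBasis.orientation.abs_volumeForm_apply_le v
  rw [Orientation.volumeForm_robust' _ b, hdet] at h
  simpa [EuclideanSpace.norm_eq, v] using h

/-- The cokernel of `n` linearly independent vectors of `ℤⁿ` has order the absolute value of their
determinant. -/
theorem card_quotient_span_eq_natAbs_det {n : ℕ} (w : Fin n → Fin n → ℤ)
    (hw : LinearIndependent ℤ w) :
    Nat.card ((Fin n → ℤ) ⧸ Submodule.span ℤ (Set.range w)) = (Matrix.of w).det.natAbs := by
  rw [← Submodule.natAbs_det_basis_change (Pi.basisFun ℤ (Fin n)) _ (Module.Basis.span hw),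
    ← Pi.basisFun_det_apply]
  congr 2
  funext i
  simp [Module.Basis.span_apply]

/-- If no nonzero element of `E` has a nonzero multiple in `L`, then the torsion of `P ⧸ L` embeds
into `P ⧸ (L ⊔ E)`, so it is bounded by any finite quotient `P ⧸ N` with `N ≤ L ⊔ E`. -/
theorem Submodule.card_torsion_quotient_le {P : Type*} [AddCommGroup P] (L E N : Submodule ℤ P)
    (hE : ∀ x ∈ E, ∀ a : ℤ, a ≠ 0 → a • x ∈ L → x = 0) (hN : N ≤ L ⊔ E) [Finite (P ⧸ N)] :
    Finite (torsion ℤ (P ⧸ L)) ∧ Nat.card (torsion ℤ (P ⧸ L)) ≤ Nat.card (P ⧸ N) := by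
  have hsurj := Submodule.factor_surjective hN
  have : Finite (P ⧸ (L ⊔ E)) := Finite.of_surjective _ hsurj
  let f : torsion ℤ (P ⧸ L) →ₗ[ℤ] P ⧸ (L ⊔ E) :=
    (Submodule.factor le_sup_left).comp (torsion ℤ (P ⧸ L)).subtype
  have hf : Function.Injective f := by
    rw [injective_iff_map_eq_zero]
    rintro ⟨x, hx⟩ hfx
    obtain ⟨x, rfl⟩ := Submodule.mkQ_surjective L x
    obtain ⟨⟨a, ha⟩, hax⟩ := hx
    have hax' : a • x ∈ L := by
      rw [← Submodule.Quotient.mk_eq_zero]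
      exact hax
    have hxs : x ∈ L ⊔ E := by
      rw [← Submodule.Quotient.mk_eq_zero]
      exact hfx
    obtain ⟨l, hl, e, he, rfl⟩ := Submodule.mem_sup.1 hxs
    have hae : a • e ∈ L := by
      have := L.sub_mem hax' (L.smul_mem a hl)
      rwa [smul_add, add_sub_cancel_left] at this
    have he0 := hE e he a (nonZeroDivisors.ne_zero ha) hae
    apply Subtype.ext
    simpa [he0] using hl
  exact ⟨Finite.of_injective f hf, (Nat.card_le_card_of_injective f hf).trans
    (Nat.card_le_card_of_surjective _ hsurj)⟩

/-- The columns of an integer matrix contain a rational basis of their span, which the standard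
basis vectors complete to a rational basis of the whole space. -/
theorem Matrix.exists_linearIndependent_columns_extension {n m : ℕ}
    (M : Matrix (Fin n) (Fin m) ℤ) :
    ∃ (w : Fin n → Fin n → ℤ) (E : Submodule ℤ (Fin n → ℤ)),
      LinearIndependent ℤ w ∧ (∀ i, (∃ j, w i = M.col j) ∨ ∃ j, w i = Pi.single j 1) ∧
      (∀ x ∈ E, ∀ a : ℤ, a ≠ 0 → a • x ∈ LinearMap.range M.mulVecLin → x = 0) ∧
      Submodule.span ℤ (Set.range w) ≤ LinearMap.range M.mulVecLin ⊔ E := by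
  classical
  let φ : (Fin n → ℤ) →ₗ[ℤ] (Fin n → ℚ) := (Algebra.linearMap ℤ ℚ).compLeft (Fin n)
  have hφ : Function.Injective φ := fun x y h => by
    funext i
    have := congrFun h i
    simpa [φ] using this
  let u : Fin m ⊕ Fin n → Fin n → ℤ := Sum.elim M.col (fun j => Pi.single j 1)
  let v : Fin m ⊕ Fin n → Fin n → ℚ := φ ∘ u
  have hspan (s : Set (Fin m ⊕ Fin n)) (x) (hx : x ∈ Submodule.span ℤ (u '' s)) :
      φ x ∈ Submodule.span ℚ (v '' s) := by
    have h := Submodule.mem_map_of_mem (f := φ) hx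
    rw [Submodule.map_span, ← Set.image_comp] at h
    exact Submodule.span_subset_span ℤ ℚ _ h
  have hrange : LinearMap.range M.mulVecLin = Submodule.span ℤ (u '' Set.range Sum.inl) := by
    rw [Matrix.range_mulVecLin, ← Set.range_comp]
    rfl
  obtain ⟨b, hb, -, hbspan, hbli⟩ := exists_linearIndepOn_extension (K := ℚ) (v := v)
    (linearIndepOn_empty ℚ v) (Set.empty_subset (Set.range Sum.inl))
  obtain ⟨c, -, hbc, hcspan, hcli⟩ := exists_linearIndepOn_extension hbli (Set.subset_univ b)
  have htop : Submodule.span ℚ (v '' c) = ⊤ := by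
    rw [eq_top_iff, ← (Pi.basisFun ℚ (Fin n)).span_eq, Submodule.span_le]
    rintro _ ⟨j, rfl⟩
    convert! hcspan ⟨Sum.inr j, Set.mem_univ _, rfl⟩
    ext i
    simp [v, u, φ, Pi.single_apply]
  let B : Module.Basis c ℚ (Fin n → ℚ) :=
    Module.Basis.mk hcli (by rw [← Set.image_eq_range, htop])
  let e : Fin n ≃ c := (Pi.basisFun ℚ (Fin n)).indexEquiv B
  have hdisj : Disjoint (Submodule.span ℚ (v '' b)) (Submodule.span ℚ (v '' (c \ b))) := by
    refine ((linearIndepOn_union_iff Set.disjoint_sdiff_right).1 ?_).2.2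
    rwa [Set.union_sdiff_cancel hbc]
  refine ⟨fun i => u (e i), Submodule.span ℤ (u '' (c \ b)), ?_, ?_, ?_, ?_⟩
  · have h : LinearIndependent ℚ (φ ∘ fun i => u (e i)) := hcli.comp e e.injective
    exact (h.restrict_scalars' ℤ).of_comp φ
  · intro i
    rcases h : (e i : Fin m ⊕ Fin n) with j | j
    · exact .inl ⟨j, by simp [u, h]⟩
    · exact .inr ⟨j, by simp [u, h]⟩
  · intro x hx a ha hax
    rw [hrange] at hax
    have h1 : (a : ℚ) • φ x ∈ Submodule.span ℚ (v '' b) := by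
      have := Submodule.span_le.2 hbspan (hspan _ _ hax)
      rwa [map_smul, ← Int.cast_smul_eq_zsmul ℚ] at this
    rw [Submodule.smul_mem_iff _ (Int.cast_ne_zero.2 ha)] at h1
    exact hφ ((Submodule.disjoint_def.1 hdisj _ h1 (hspan _ _ hx)).trans (map_zero φ).symm)
  · rw [Submodule.span_le, hrange]
    rintro _ ⟨i, rfl⟩
    by_cases hi : (e i : Fin m ⊕ Fin n) ∈ b
    · exact Submodule.mem_sup_left (Submodule.subset_span ⟨_, hb hi, rfl⟩)
    · exact Submodule.mem_sup_right (Submodule.subset_span ⟨_, ⟨(e i).2, hi⟩, rfl⟩)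

/-- If `M` is an integer matrix with `n` rows whose columns all have
Euclidean norm at most `t ≥ 1`, then the torsion subgroup of `coker(M) = ℤⁿ/Im(M)` is finite
of order at most `t^n`. -/
theorem torsion_card_le_of_column_norm (n m : ℕ) (M : Matrix (Fin n) (Fin m) ℤ)
    (t : ℝ) (ht : 1 ≤ t)
    (hcol : ∀ j : Fin m, Real.sqrt (∑ i : Fin n, ((M i j : ℝ)) ^ 2) ≤ t) :
    Finite (Submodule.torsion ℤ ((Fin n → ℤ) ⧸ LinearMap.range (Matrix.mulVecLin M))) ∧
    (Nat.card (Submodule.torsion ℤ ((Fin n → ℤ) ⧸ LinearMap.range (Matrix.mulVecLin M))) : ℝ)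
      ≤ t ^ n := by
  obtain ⟨w, E, hw, hwM, hE, hN⟩ := M.exists_linearIndependent_columns_extension
  have hcard := card_quotient_span_eq_natAbs_det w hw
  have hdet : (Matrix.of w).det ≠ 0 := by
    rw [Ne, ← Matrix.exists_vecMul_eq_zero_iff]
    rintro ⟨x, hx, hxw⟩
    exact hx (Matrix.vecMul_injective_iff.2 hw (hxw.trans (Matrix.zero_vecMul _).symm))
  have : Finite ((Fin n → ℤ) ⧸ Submodule.span ℤ (Set.range w)) :=
    Nat.finite_of_card_ne_zero (by rwa [hcard, Int.natAbs_ne_zero])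
  obtain ⟨hfin, hle⟩ := Submodule.card_torsion_quotient_le _ E _ hE hN
  refine ⟨hfin, (Nat.cast_le.2 hle).trans ?_⟩
  rw [hcard, Nat.cast_natAbs, Int.cast_abs, Int.cast_det]
  refine (Matrix.abs_det_le_prod_sqrt_sum_sq _).trans ?_
  refine (Finset.prod_le_prod (fun _ _ => Real.sqrt_nonneg _) (g := fun _ => t) ?_).trans
    (by simp)
  intro i _
  rcases hwM i with ⟨j, hj⟩ | ⟨j, hj⟩
  · simpa [hj] using hcol j
  · simpa [hj, Pi.single_apply] using ht
end

section
/- Let M be an integer matrix and let S be a minimal torsion cocycle of M. Then the rank over ℚ of the submatrix M_S equals |S|. -/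
/-- The submatrix of `M` consisting of the columns indexed by `S`. -/
def colSubmatrix {m n : ℕ} (M : Matrix (Fin m) (Fin n) ℤ) (S : Finset (Fin n)) :
    Matrix (Fin m) {j // j ∈ S} ℤ :=
  M.submatrix id (fun j => (j : Fin n))

/-- `S` is a torsion cocycle of `M` if there is a prime `q` such that the rank of `M_S`
over `ℚ` is strictly greater than the rank of `M_S` reduced mod `q` over `ℤ/qℤ`. -/
def IsTorsionCocycle {m n : ℕ} (M : Matrix (Fin m) (Fin n) ℤ) (S : Finset (Fin n)) : Prop :=
  ∃ q : ℕ, q.Prime ∧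
    ((colSubmatrix M S).map (Int.cast : ℤ → ZMod q)).rank <
      ((colSubmatrix M S).map (Int.cast : ℤ → ℚ)).rank

/-- `S` is a minimal torsion cocycle of `M` if it is a torsion cocycle and no proper subset
of `S` is a torsion cocycle. -/
def IsMinimalTorsionCocycle {m n : ℕ} (M : Matrix (Fin m) (Fin n) ℤ) (S : Finset (Fin n)) :
    Prop :=
  IsTorsionCocycle M S ∧ ∀ T ⊂ S, ¬ IsTorsionCocycle M T

/-- The rank of a matrix of selected columns is the dimension of the span of these columns. -/
theorem rank_colSubmatrix_map {m n : ℕ} {K : Type*} [Field K] (f : ℤ → K)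
    (M : Matrix (Fin m) (Fin n) ℤ) (S : Finset (Fin n)) :
    ((colSubmatrix M S).map f).rank =
      Module.finrank K (Submodule.span K ((M.map f).col '' (S : Set (Fin n)))) := by
  rw [Matrix.rank_eq_finrank_span_cols, Set.image_eq_range]
  rfl

/-- Every set of columns contains a set of linearly independent columns spanning the same
space. -/
theorem exists_subset_card_eq_rank_colSubmatrix {m n : ℕ} {K : Type*} [Field K] (f : ℤ → K)
    (M : Matrix (Fin m) (Fin n) ℤ) (S : Finset (Fin n)) :
    ∃ T ⊆ S, ((colSubmatrix M T).map f).rank = T.card ∧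
      ((colSubmatrix M T).map f).rank = ((colSubmatrix M S).map f).rank := by
  classical
  obtain ⟨κ, a, ha, hspan, hli⟩ :=
    exists_linearIndependent' K (fun j : {j // j ∈ S} => (M.map f).col j)
  have : Finite κ := Finite.of_injective a ha
  have : Fintype κ := Fintype.ofFinite κ
  have hinj : Function.Injective fun k => (a k : Fin n) := Subtype.val_injective.comp ha
  let T : Finset (Fin n) := Finset.univ.image fun k => (a k : Fin n)
  have hT : (M.map f).col '' (T : Set (Fin n)) =
      Set.range ((fun j : {j // j ∈ S} => (M.map f).col j) ∘ a) := by
    simp only [T, Finset.coe_image, Finset.coe_univ, Set.image_univ, ← Set.range_comp]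
    rfl
  refine ⟨T, ?_, ?_, ?_⟩
  · intro j hj
    obtain ⟨k, -, rfl⟩ := Finset.mem_image.mp hj
    exact (a k).2
  · rw [rank_colSubmatrix_map, hT, finrank_span_eq_card hli,
      Finset.card_image_of_injective _ hinj, Finset.card_univ]
  · rw [rank_colSubmatrix_map, rank_colSubmatrix_map, hT, hspan, Set.image_eq_range]
    rfl

theorem rank_colSubmatrix_map_mono {m n : ℕ} {K : Type*} [Field K] (f : ℤ → K)
    (M : Matrix (Fin m) (Fin n) ℤ) {S T : Finset (Fin n)} (h : T ⊆ S) :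
    ((colSubmatrix M T).map f).rank ≤ ((colSubmatrix M S).map f).rank := by
  rw [rank_colSubmatrix_map, rank_colSubmatrix_map]
  exact Submodule.finrank_mono (Submodule.span_mono (Set.image_mono (Finset.coe_subset.mpr h)))

/-- If `S` is a minimal torsion cocycle of an integer matrix `M`, then the
rank of `M_S` over `ℚ` equals `|S|`. -/
theorem rank_eq_card_of_minimal_torsion_cocycle {m n : ℕ} (M : Matrix (Fin m) (Fin n) ℤ)
    (S : Finset (Fin n)) (hS : IsMinimalTorsionCocycle M S) :
    ((colSubmatrix M S).map (Int.cast : ℤ → ℚ)).rank = S.card := by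
  obtain ⟨⟨q, hq, hlt⟩, hmin⟩ := hS
  have : Fact q.Prime := ⟨hq⟩
  obtain ⟨T, hTS, hcard, hrank⟩ :=
    exists_subset_card_eq_rank_colSubmatrix (Int.cast : ℤ → ℚ) M S
  have hT : IsTorsionCocycle M T :=
    ⟨q, hq, (rank_colSubmatrix_map_mono _ M hTS).trans_lt (hlt.trans_eq hrank.symm)⟩
  obtain rfl : T = S := by
    by_contra hne
    exact hmin T (hTS.ssubset_of_ne hne) hT
  exact hcard
end

section
/- Fix an integer k ≥ 3, a constant δ ∈ (0,1), and a function p : ℕ → [0,1] with n^{k-1}·p(n) → ∞ as n → ∞. Then asymptotically almost surely, H ~ H_k(n, p(n)) contains no subset of vertices W with 1 ≤ |W| ≤ δn such that both: (i) no hyperedge of H intersects W in exactly one vertex, and (ii) at least |W| hyperedges of H intersect W. -/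
open Finset Filter
open scoped Classical

/-- The probability that a random subset of `E` (each element kept independently with probability
`p`) contains `S` and avoids `A`. -/
theorem sum_weight_of_subset_of_disjoint {α : Type*} [DecidableEq α] (E S A : Finset α)
    (hS : S ⊆ E) (hA : A ⊆ E) (hSA : Disjoint S A) (p : ℝ) :
    ∑ H ∈ E.powerset with S ⊆ H ∧ Disjoint H A, p ^ #H * (1 - p) ^ (#E - #H) =
      p ^ #S * (1 - p) ^ #A := by
  have hcard : #(E \ (S ∪ A)) + (#S + #A) = #E := by
    rw [← card_union_of_disjoint hSA, card_sdiff_add_card_eq_card (union_subset hS hA)]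
  have hbij : ∑ H ∈ E.powerset with S ⊆ H ∧ Disjoint H A, p ^ #H * (1 - p) ^ (#E - #H) =
      ∑ T ∈ (E \ (S ∪ A)).powerset,
        p ^ #S * (1 - p) ^ #A * (p ^ #T * (1 - p) ^ (#(E \ (S ∪ A)) - #T)) := by
    refine sum_bij' (fun H _ => H \ S) (fun T _ => S ∪ T) ?_ ?_ ?_ ?_ ?_
    · intro H hH
      simp only [mem_filter, mem_powerset] at hH ⊢
      obtain ⟨h1, -, h3⟩ := hH
      intro x hx
      simp only [Finset.mem_sdiff, mem_union, not_or] at hx ⊢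
      exact ⟨h1 hx.1, hx.2, disjoint_left.1 h3 hx.1⟩
    · intro T hT
      simp only [mem_filter, mem_powerset] at hT ⊢
      refine ⟨union_subset hS (hT.trans sdiff_subset), subset_union_left, ?_⟩
      rw [disjoint_union_left]
      refine ⟨hSA, disjoint_left.2 fun x hx => ?_⟩
      have := hT hx
      simp only [Finset.mem_sdiff, mem_union, not_or] at this
      exact this.2.2
    · intro H hH
      simp only [mem_filter, mem_powerset] at hH
      exact union_sdiff_of_subset hH.2.1
    · intro T hT
      rw [mem_powerset] at hT
      refine union_sdiff_cancel_left (disjoint_right.2 fun x hx => ?_)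
      have := hT hx
      simp only [Finset.mem_sdiff, mem_union, not_or] at this
      exact this.2.1
    · intro H hH
      simp only [mem_filter, mem_powerset] at hH
      obtain ⟨h1, h2, h3⟩ := hH
      have e1 : #(H \ S) + #S = #H := card_sdiff_add_card_eq_card h2
      have e2 : #H + #A ≤ #E := by
        rw [← card_union_of_disjoint h3]
        exact card_le_card (union_subset h1 hA)
      have e3 : #E - #H = #A + (#(E \ (S ∪ A)) - #(H \ S)) := by omega
      rw [e3, ← e1, pow_add, pow_add]
      ring
  rw [hbij, ← mul_sum, sum_pow_mul_eq_add_pow]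
  simp

theorem erProb_not (n k : ℕ) (p : ℝ) (P : Finset (Finset (Fin n)) → Prop) :
    erProb n k p (fun H => ¬ P H) = 1 - erProb n k p P := by
  have h := sum_filter_add_sum_filter_not (edgeSet n k).powerset P
    (fun H => p ^ #H * (1 - p) ^ (#(edgeSet n k) - #H))
  rw [sum_pow_mul_eq_add_pow] at h
  simp only [add_sub_cancel, one_pow] at h
  refine eq_sub_of_add_eq' ?_
  rw [← h]
  unfold erProb
  congr!

theorem erProb_nonneg (n k : ℕ) {p : ℝ} (hp0 : 0 ≤ p) (hp1 : p ≤ 1)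
    (P : Finset (Finset (Fin n)) → Prop) : 0 ≤ erProb n k p P := by
  have := sub_nonneg.2 hp1
  exact sum_nonneg fun H _ => by positivity

/-- Union bound. -/
theorem erProb_exists_le {ι : Type*} (n k : ℕ) {p : ℝ} (hp0 : 0 ≤ p) (hp1 : p ≤ 1)
    (I : Finset ι) (P : Finset (Finset (Fin n)) → Prop)
    (Q : ι → Finset (Finset (Fin n)) → Prop)
    (hPQ : ∀ H ⊆ edgeSet n k, P H → ∃ i ∈ I, Q i H) :
    erProb n k p P ≤ ∑ i ∈ I, erProb n k p (Q i) := by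
  have h0 := sub_nonneg.2 hp1
  unfold erProb
  simp only [sum_filter]
  rw [sum_comm]
  refine sum_le_sum fun H hH => ?_
  have hterm : ∀ i ∈ I, 0 ≤ if Q i H then p ^ #H * (1 - p) ^ (#(edgeSet n k) - #H) else 0 :=
    fun i _ => by positivity
  split_ifs with hP
  · obtain ⟨i, hi, hQ⟩ := hPQ H (mem_powerset.1 hH) hP
    refine le_trans ?_ (single_le_sum hterm hi)
    rw [if_pos hQ]
  · exact sum_nonneg hterm

/-- The possible hyperedges meeting `W` in exactly one vertex. -/
noncomputable def singleEdges (n k : ℕ) (W : Finset (Fin n)) : Finset (Finset (Fin n)) :=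
  (edgeSet n k).filter fun e => #(e ∩ W) = 1

/-- The possible hyperedges meeting `W` in at least two vertices. -/
noncomputable def multiEdges (n k : ℕ) (W : Finset (Fin n)) : Finset (Finset (Fin n)) :=
  (edgeSet n k).filter fun e => 2 ≤ #(e ∩ W)

theorem card_multiEdges_le {n k : ℕ} (W : Finset (Fin n)) :
    #(multiEdges n k W) ≤ #W ^ 2 * n ^ (k - 2) := by
  have hsub : multiEdges n k W ⊆ (powersetCard 2 W).biUnion fun s =>
      (powersetCard (k - 2) (univ : Finset (Fin n))).image fun t => s ∪ t := by
    intro e he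
    simp only [multiEdges, edgeSet, mem_filter, mem_powersetCard, subset_univ, true_and] at he
    obtain ⟨s, hs, hs2⟩ := exists_subset_card_eq he.2
    have hse : s ⊆ e := hs.trans inter_subset_left
    refine mem_biUnion.2 ⟨s, mem_powersetCard.2 ⟨hs.trans inter_subset_right, hs2⟩,
      mem_image.2 ⟨e \ s, mem_powersetCard.2 ⟨subset_univ _, ?_⟩, union_sdiff_of_subset hse⟩⟩
    rw [card_sdiff_of_subset hse, he.1, hs2]
  refine (card_le_card hsub).trans ((card_biUnion_le_card_mul _ _ (n ^ (k - 2)) ?_).trans ?_)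
  · intro s _
    refine card_image_le.trans ?_
    rw [card_powersetCard, card_univ, Fintype.card_fin]
    exact Nat.choose_le_pow _ _
  · rw [card_powersetCard]
    exact Nat.mul_le_mul_right _ (Nat.choose_le_pow _ _)

theorem le_card_singleEdges {n k : ℕ} (hk : 1 ≤ k) (W : Finset (Fin n)) :
    #W * (n - #W).choose (k - 1) ≤ #(singleEdges n k W) := by
  have hc : #(W ×ˢ powersetCard (k - 1) Wᶜ) = #W * (n - #W).choose (k - 1) := by
    rw [card_product, card_powersetCard, card_compl, Fintype.card_fin]
  rw [← hc]
  have hinter : ∀ x : Fin n × Finset (Fin n), x ∈ W ×ˢ powersetCard (k - 1) Wᶜ →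
      insert x.1 x.2 ∩ W = {x.1} ∧ insert x.1 x.2 \ W = x.2 ∧ x.1 ∉ x.2 := by
    intro x hx
    rw [mem_product, mem_powersetCard] at hx
    obtain ⟨h1, h2, -⟩ := hx
    have h3 : ∀ y ∈ x.2, y ∉ W := fun y hy => mem_compl.1 (h2 hy)
    refine ⟨?_, ?_, fun h => h3 _ h h1⟩
    · ext y; simp only [Finset.mem_inter, mem_insert, mem_singleton]; grind
    · ext y; simp only [Finset.mem_sdiff, mem_insert]; grind
  refine card_le_card_of_injOn (fun x => insert x.1 x.2) ?_ ?_
  · intro x hx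
    obtain ⟨h1, -, h3⟩ := hinter x hx
    have hx' := (mem_powersetCard.1 (mem_product.1 hx).2).2
    simp only [singleEdges, edgeSet, coe_filter, mem_powersetCard, subset_univ, true_and,
      Set.mem_ofPred_eq]
    rw [h1, card_insert_of_notMem h3, hx', card_singleton]
    omega
  · intro x hx y hy hxy
    obtain ⟨a1, a2, -⟩ := hinter x hx
    obtain ⟨b1, b2, -⟩ := hinter y hy
    simp only at hxy
    rw [hxy] at a1 a2
    exact Prod.ext (singleton_injective (a1.symm.trans b1)) (a2.symm.trans b2)

/-- First-moment bound for a fixed vertex set `W`. -/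
theorem erProb_fixed_le {n k : ℕ} {p : ℝ} (hp0 : 0 ≤ p) (hp1 : p ≤ 1) (W : Finset (Fin n)) :
    erProb n k p (fun H => (∀ e ∈ H, #(e ∩ W) ≠ 1) ∧
        #W ≤ #(H.filter fun e => (e ∩ W).Nonempty)) ≤
      (#(multiEdges n k W)).choose #W * (p ^ #W * (1 - p) ^ #(singleEdges n k W)) := by
  refine (erProb_exists_le n k hp0 hp1 (powersetCard #W (multiEdges n k W)) _
    (fun S H => S ⊆ H ∧ Disjoint H (singleEdges n k W)) ?_).trans ?_
  · rintro H hH ⟨h1, h2⟩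
    obtain ⟨S, hS, hSc⟩ := exists_subset_card_eq h2
    refine ⟨S, mem_powersetCard.2 ⟨fun e he => ?_, hSc⟩, hS.trans (filter_subset _ _), ?_⟩
    · have he' := mem_filter.1 (hS he)
      have := card_pos.2 he'.2
      have := h1 e he'.1
      exact mem_filter.2 ⟨hH he'.1, by omega⟩
    · exact disjoint_left.2 fun e he he' => h1 e he (mem_filter.1 he').2
  · rw [← card_powersetCard, ← nsmul_eq_mul]
    refine sum_le_card_nsmul _ _ _ fun S hS => ?_
    rw [mem_powersetCard] at hS
    have hdisj : Disjoint S (singleEdges n k W) := disjoint_left.2 fun e he he' => by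
      have h1 := (mem_filter.1 (hS.1 he)).2
      have h2 := (mem_filter.1 he').2
      omega
    have := sum_weight_of_subset_of_disjoint (edgeSet n k) S (singleEdges n k W)
      (hS.1.trans (filter_subset _ _)) (filter_subset _ _) hdisj p
    rw [hS.2] at this
    rw [← this]
    unfold erProb
    exact le_of_eq (by congr!)

theorem choose_le_exp_mul_div_pow (n : ℕ) {w : ℕ} (hw : 1 ≤ w) :
    (n.choose w : ℝ) ≤ (Real.exp 1 * n / w) ^ w := by
  have hw0 : (0 : ℝ) < w := by exact_mod_cast hw
  have h1 : (n.choose w : ℝ) ≤ (n : ℝ) ^ w / w.factorial := Nat.choose_le_pow_div _ _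
  have h2 := Real.pow_div_factorial_le_exp (w : ℝ) hw0.le w
  have h3 : Real.exp (w : ℝ) = Real.exp 1 ^ w := by rw [← Real.exp_nat_mul, mul_one]
  rw [h3] at h2
  calc (n.choose w : ℝ) ≤ (n : ℝ) ^ w / w.factorial := h1
    _ = ((n : ℝ) / w) ^ w * ((w : ℝ) ^ w / w.factorial) := by
        rw [div_pow]; field_simp
    _ ≤ ((n : ℝ) / w) ^ w * Real.exp 1 ^ w := by gcongr
    _ = _ := by rw [← mul_pow]; congr 1; ring

/-- A linear lower bound, in terms of the expected degree, for the number of possible hyperedges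
meeting a small set exactly once. -/
theorem le_card_singleEdges_real {n k : ℕ} (hk : 1 ≤ k) {δ : ℝ} (hδ1 : δ < 1)
    (hn : 2 * (k : ℝ) ≤ (1 - δ) * n) (W : Finset (Fin n)) (hW : (#W : ℝ) ≤ δ * n) :
    (#W : ℝ) * (((1 - δ) / 2) ^ (k - 1) / (k - 1).factorial * (n : ℝ) ^ (k - 1)) ≤
      #(singleEdges n k W) := by
  have hwn : #W ≤ n := by simpa using card_le_univ W
  have hm : ((n - #W : ℕ) : ℝ) = n - #W := by push_cast [hwn]; ring
  have h1 : (#W : ℝ) * ((n - #W).choose (k - 1) : ℕ) ≤ #(singleEdges n k W) := by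
    exact_mod_cast le_card_singleEdges hk W
  have h2 : (((n - #W + 1 - (k - 1) : ℕ) : ℝ) ^ (k - 1)) / (k - 1).factorial ≤
      ((n - #W).choose (k - 1) : ℕ) := by
    have := Nat.pow_le_choose (α := ℝ) (k - 1) (n - #W)
    exact_mod_cast this
  have hk' : (k - 1 : ℕ) ≤ n - #W + 1 := by
    have : (k : ℝ) ≤ (n - #W : ℕ) := by
      rw [hm]
      have : (0 : ℝ) ≤ k := by positivity
      linarith
    have : k ≤ n - #W := by exact_mod_cast this
    omega
  have h3 : (1 - δ) / 2 * n ≤ (n - #W + 1 - (k - 1) : ℕ) := by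
    rw [Nat.cast_sub hk', Nat.cast_add, hm, Nat.cast_sub hk]
    push_cast
    linarith
  have h4 : 0 ≤ 1 - δ := by linarith
  refine le_trans ?_ h1
  gcongr
  refine le_trans ?_ h2
  rw [div_mul_eq_mul_div, ← mul_pow]
  gcongr

/-- The first-moment contribution of all vertex sets of the size of `W`. -/
theorem choose_mul_fixed_le {n k : ℕ} (hk : 2 ≤ k) {p c : ℝ} (hp0 : 0 ≤ p) (hp1 : p ≤ 1)
    (W : Finset (Fin n)) (hW : 1 ≤ #W)
    (hc : (#W : ℝ) * (c * (n : ℝ) ^ (k - 1)) ≤ #(singleEdges n k W)) :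
    (n.choose #W : ℝ) *
        ((#(multiEdges n k W)).choose #W * (p ^ #W * (1 - p) ^ #(singleEdges n k W))) ≤
      (Real.exp 1 ^ 2 * ((n : ℝ) ^ (k - 1) * p * Real.exp (-(c * ((n : ℝ) ^ (k - 1) * p))))) ^ #W
      := by
  have hw0 : (0 : ℝ) < #W := by exact_mod_cast hW
  have hq : 0 ≤ 1 - p := sub_nonneg.2 hp1
  have hB : (#(multiEdges n k W) : ℝ) ≤ (#W : ℝ) ^ 2 * (n : ℝ) ^ (k - 2) := by
    exact_mod_cast card_multiEdges_le W
  have h1 := choose_le_exp_mul_div_pow n hW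
  have h2 : ((#(multiEdges n k W)).choose #W : ℝ) ≤
      (Real.exp 1 * ((#W : ℝ) * (n : ℝ) ^ (k - 2))) ^ #W := by
    refine (choose_le_exp_mul_div_pow _ hW).trans ?_
    gcongr
    rw [div_le_iff₀ hw0]
    calc Real.exp 1 * (#(multiEdges n k W) : ℝ)
        ≤ Real.exp 1 * ((#W : ℝ) ^ 2 * (n : ℝ) ^ (k - 2)) := by gcongr
      _ = _ := by ring
  have h3 : (1 - p) ^ #(singleEdges n k W) ≤
      Real.exp (-(c * ((n : ℝ) ^ (k - 1) * p))) ^ #W := by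
    calc (1 - p) ^ #(singleEdges n k W) ≤ Real.exp (-p) ^ #(singleEdges n k W) := by
          gcongr
          exact Real.one_sub_le_exp_neg p
      _ = Real.exp (#(singleEdges n k W) * -p) := (Real.exp_nat_mul _ _).symm
      _ ≤ Real.exp (#W * -(c * ((n : ℝ) ^ (k - 1) * p))) := by
          refine Real.exp_le_exp.2 ?_
          nlinarith
      _ = _ := Real.exp_nat_mul _ _
  calc _ ≤ (Real.exp 1 * n / #W) ^ #W * ((Real.exp 1 * ((#W : ℝ) * (n : ℝ) ^ (k - 2))) ^ #W *
        (p ^ #W * Real.exp (-(c * ((n : ℝ) ^ (k - 1) * p))) ^ #W)) := by gcongr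
    _ = _ := by
        rw [← mul_pow, ← mul_pow, ← mul_pow]
        congr 1
        generalize Real.exp (-(c * ((n : ℝ) ^ (k - 1) * p))) = E
        have : k - 1 = k - 2 + 1 := by omega
        rw [this]
        field_simp
        ring

theorem sum_pow_card_div_choose_le {n : ℕ} {x : ℝ} (hx0 : 0 ≤ x) (hx : x ≤ 1 / 2) :
    ∑ W : Finset (Fin n) with 1 ≤ #W, x ^ #W / (n.choose #W : ℝ) ≤ 2 * x := by
  rw [sum_filter, ← powerset_univ,
    sum_powerset_apply_card (fun w => if 1 ≤ w then x ^ w / (n.choose w : ℝ) else 0), card_univ,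
    Fintype.card_fin, sum_range_succ']
  simp only [le_add_iff_nonneg_left, zero_le, if_true, nsmul_eq_mul, nonpos_iff_eq_zero,
    one_ne_zero, if_false, mul_zero, add_zero]
  calc _ = ∑ w ∈ range n, x * x ^ w := by
        refine sum_congr rfl fun w hw => ?_
        have : (n.choose (w + 1) : ℝ) ≠ 0 := by
          have := Nat.choose_pos (Nat.succ_le_of_lt (mem_range.1 hw))
          positivity
        rw [mul_div_cancel₀ _ this, pow_succ, mul_comm]
    _ = x * ∑ w ∈ range n, x ^ w := (mul_sum _ _ _).symm
    _ ≤ x * ∑ w ∈ range n, (1 / 2 : ℝ) ^ w := by gcongr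
    _ ≤ x * 2 := by gcongr; exact sum_geometric_two_le n
    _ = 2 * x := mul_comm _ _

/-- For `k ≥ 3`, `δ ∈ (0,1)` and `p` with `n^(k-1)·p(n) → ∞`, a.a.s.
`H ~ H_k(n, p(n))` contains no vertex subset `W` with `1 ≤ |W| ≤ δn` such that no hyperedge
intersects `W` in exactly one vertex and at least `|W|` hyperedges intersect `W`. -/
theorem no_small_cocycle_support (k : ℕ) (hk : 3 ≤ k) (δ : ℝ) (hδ0 : 0 < δ) (hδ1 : δ < 1)
    (p : ℕ → ℝ) (hp : ∀ n, p n ∈ Set.Icc (0 : ℝ) 1)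
    (hgrow : Tendsto (fun n : ℕ => (n : ℝ) ^ (k - 1) * p n) atTop atTop) :
    Tendsto (fun n => erProb n k (p n) (fun H =>
      ¬ ∃ W : Finset (Fin n), 1 ≤ W.card ∧ (W.card : ℝ) ≤ δ * n ∧
        (∀ e ∈ H, (e ∩ W).card ≠ 1) ∧
        W.card ≤ (H.filter (fun e => (e ∩ W).Nonempty)).card))
      atTop (nhds 1) := by
  simp only [erProb_not]
  rw [show nhds (1 : ℝ) = nhds (1 - 0) by rw [sub_zero]]
  refine Tendsto.const_sub 1 ?_
  set c : ℝ := ((1 - δ) / 2) ^ (k - 1) / (k - 1).factorial with hc_def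
  have hδ : 0 < 1 - δ := sub_pos.2 hδ1
  have hc : 0 < c := by positivity
  set x : ℕ → ℝ := fun n => Real.exp 1 ^ 2 *
    ((n : ℝ) ^ (k - 1) * p n * Real.exp (-(c * ((n : ℝ) ^ (k - 1) * p n)))) with hx_def
  have hx : Tendsto x atTop (nhds 0) := by
    have h : Tendsto (fun t : ℝ => t * Real.exp (-(c * t))) atTop (nhds 0) := by
      simpa using tendsto_rpow_mul_exp_neg_mul_atTop_nhds_zero 1 c hc
    simpa using (h.comp hgrow).const_mul (Real.exp 1 ^ 2)
  have hlarge : ∀ᶠ n : ℕ in atTop, 2 * (k : ℝ) ≤ (1 - δ) * n :=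
    (tendsto_natCast_atTop_atTop.const_mul_atTop hδ).eventually_ge_atTop _
  refine squeeze_zero' (Eventually.of_forall fun n => erProb_nonneg n k (hp n).1 (hp n).2 _) ?_
    (by simpa using hx.const_mul 2)
  filter_upwards [hlarge, hx.eventually_le_const (by norm_num : (0 : ℝ) < 1 / 2)] with n hn hxn
  have hp0 := (hp n).1
  have hx0 : 0 ≤ x n := by positivity
  calc _ ≤ ∑ W : Finset (Fin n) with 1 ≤ #W ∧ (#W : ℝ) ≤ δ * n,
        erProb n k (p n) (fun H => (∀ e ∈ H, #(e ∩ W) ≠ 1) ∧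
          #W ≤ #(H.filter fun e => (e ∩ W).Nonempty)) := by
        refine erProb_exists_le n k hp0 (hp n).2 _ _ _ ?_
        rintro H - ⟨W, h1, h2, h3⟩
        exact ⟨W, mem_filter.2 ⟨mem_univ _, h1, h2⟩, h3⟩
    _ ≤ ∑ W : Finset (Fin n) with 1 ≤ #W ∧ (#W : ℝ) ≤ δ * n, x n ^ #W / (n.choose #W : ℝ) := by
        refine sum_le_sum fun W hW => ?_
        obtain ⟨-, h1, h2⟩ := mem_filter.1 hW
        refine (erProb_fixed_le hp0 (hp n).2 W).trans ?_
        have hpos : (0 : ℝ) < n.choose #W := by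
          exact_mod_cast Nat.choose_pos (by simpa using card_le_univ W)
        rw [le_div_iff₀' hpos]
        exact choose_mul_fixed_le (by omega) hp0 (hp n).2 W h1
          (le_card_singleEdges_real (by omega) hδ1 hn W h2)
    _ ≤ ∑ W : Finset (Fin n) with 1 ≤ #W, x n ^ #W / (n.choose #W : ℝ) := by
        refine sum_le_sum_of_subset_of_nonneg (fun W hW => ?_) fun W _ _ => by positivity
        exact mem_filter.2 ⟨mem_univ _, (mem_filter.1 hW).2.1⟩
    _ ≤ 2 * x n := sum_pow_card_div_choose_le hx0 hxn
end

section
/- Let k ≥ 4 be even and let 0 < ε < (k-1)!/k^k. There exists a constant γ = γ(k, ε) > 0 such that for every n, every prime q, and every ε-balanced vector v ∈ (ℤ/qℤ)^n, |B_q(v)| ≥ γ·|supp(v)|^k. -/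
open Finset
open scoped Classical

/-- `w ∈ V_{k,n}`: `w ∈ ℤⁿ` has exactly `k` nonzero entries and its nonzero entries, read in
order of increasing coordinate index, are `1, -1, 1, -1, ...`. -/
def MemVkn (k n : ℕ) (w : Fin n → ℤ) : Prop :=
  (Finset.univ.filter (fun i => w i ≠ 0)).card = k ∧
    ∀ i, w i ≠ 0 → w i = (-1 : ℤ) ^ (Finset.univ.filter (fun j => j < i ∧ w j ≠ 0)).card

/-- `B_q(v) = { w ∈ V_{k,n} : w·v ≠ 0 over ℤ/qℤ }`, where `w` is reduced mod `q` before
taking the dot product. -/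
def Bq {n : ℕ} (k q : ℕ) (v : Fin n → ZMod q) : Set (Fin n → ℤ) :=
  {w | MemVkn k n w ∧ ∑ i, (w i : ZMod q) * v i ≠ 0}

/-- The support of a vector: the set of coordinates where it is nonzero. -/
def suppCard {n : ℕ} {q : ℕ} (v : Fin n → ZMod q) : ℕ :=
  (Finset.univ.filter (fun i => v i ≠ 0)).card

/-- A vector `v ∈ (ℤ/qℤ)ⁿ` is `ε`-balanced if every nonzero element of `ℤ/qℤ` appears at most
`ε·|supp(v)|` times among the entries of `v`. -/
def EpsBalanced {n q : ℕ} (ε : ℝ) (v : Fin n → ZMod q) : Prop :=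
  ∀ x : ZMod q, x ≠ 0 →
    ((Finset.univ.filter (fun i => v i = x)).card : ℝ) ≤ ε * (suppCard v : ℝ)

/-- The vector supported on `T` whose nonzero entries are alternately `1` and `-1`. -/
def alternatingVec {n : ℕ} (T : Finset (Fin n)) (i : Fin n) : ℤ :=
  if i ∈ T then (-1) ^ (T.filter (· < i)).card else 0

lemma alternatingVec_ne_zero_iff {n : ℕ} (T : Finset (Fin n)) (i : Fin n) :
    alternatingVec T i ≠ 0 ↔ i ∈ T := by
  unfold alternatingVec
  split_ifs with h <;> simp [h]

lemma alternatingVec_injective {n : ℕ} :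
    Function.Injective (alternatingVec : Finset (Fin n) → Fin n → ℤ) := by
  intro S T h
  ext i
  rw [← alternatingVec_ne_zero_iff, h, alternatingVec_ne_zero_iff]

lemma memVkn_alternatingVec {n : ℕ} (T : Finset (Fin n)) :
    MemVkn T.card n (alternatingVec T) := by
  refine ⟨by simp [alternatingVec_ne_zero_iff], fun i hi => ?_⟩
  rw [alternatingVec_ne_zero_iff] at hi
  rw [alternatingVec, if_pos hi]
  congr 2
  ext j
  simp [alternatingVec_ne_zero_iff, and_comm]

lemma MemVkn.eq_alternatingVec {k n : ℕ} {w : Fin n → ℤ} (h : MemVkn k n w) :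
    w = alternatingVec (univ.filter fun i => w i ≠ 0) := by
  ext i
  by_cases hi : w i = 0
  · simp [alternatingVec, hi]
  · rw [alternatingVec, if_pos (by simpa using hi), h.2 i hi]
    congr 2
    ext j
    simp [and_comm]

lemma finite_Bq {n : ℕ} (k q : ℕ) (v : Fin n → ZMod q) : (Bq k q v).Finite :=
  (Set.finite_range (alternatingVec : Finset (Fin n) → Fin n → ℤ)).subset
    fun _ hw => ⟨_, hw.1.eq_alternatingVec.symm⟩

/-- The alternating sum of the entries of `v` over the coordinates in `T`. -/
def alternatingSum {n q : ℕ} (v : Fin n → ZMod q) (T : Finset (Fin n)) : ZMod q :=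
  ∑ i, (alternatingVec T i : ZMod q) * v i

lemma alternatingSum_eq {n q : ℕ} (v : Fin n → ZMod q) (T : Finset (Fin n)) :
    alternatingSum v T = ∑ i ∈ T, (-1) ^ (T.filter (· < i)).card * v i := by
  simp [alternatingSum, alternatingVec, Finset.sum_ite_mem, ite_mul, apply_ite]

lemma card_alternatingSum_ne_zero_le {n : ℕ} (k q : ℕ) (v : Fin n → ZMod q) :
    ((powersetCard k univ).filter fun T => alternatingSum v T ≠ 0).card ≤ (Bq k q v).ncard := by
  rw [← Set.ncard_coe_finset]
  refine Set.ncard_le_ncard_of_injOn alternatingVec ?_ alternatingVec_injective.injOn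
    (finite_Bq k q v)
  intro T hT
  simp only [coe_filter, mem_powersetCard_univ, Set.mem_ofPred_eq] at hT
  exact ⟨hT.1 ▸ memVkn_alternatingVec T, hT.2⟩

/-- Exchanging an element of a set for an adjacent one changes the alternating sum by
`±` the difference of the two entries. -/
lemma eq_of_alternatingSum_insert_eq {n q : ℕ} (v : Fin n → ZMod q) (U : Finset (Fin n))
    {a b : Fin n} (ha : a ∉ U) (hb : b ∉ U) (hab : ∀ i ∈ U, i < a ↔ i < b)
    (h : alternatingSum v (insert a U) = alternatingSum v (insert b U)) : v a = v b := by
  have hrest : ∀ i ∈ U, ((insert a U).filter (· < i)).card = ((insert b U).filter (· < i)).card := by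
    intro i hi
    have hia : i ≠ a := fun e => ha (e ▸ hi)
    have hib : i ≠ b := fun e => hb (e ▸ hi)
    have hlt : a < i ↔ b < i := by
      have := hab i hi
      constructor <;> intro hh <;> grind
    rw [filter_insert, filter_insert]
    by_cases hai : a < i
    · rw [if_pos hai, if_pos (hlt.1 hai), card_insert_of_notMem (by simp [ha]),
        card_insert_of_notMem (by simp [hb])]
    · rw [if_neg hai, if_neg (fun hh => hai (hlt.2 hh))]
  have hpos : (U.filter (· < a)) = (U.filter (· < b)) := filter_congr hab
  rw [alternatingSum_eq, alternatingSum_eq, sum_insert ha, sum_insert hb,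
    sum_congr rfl (fun i hi => by rw [hrest i hi]), add_left_inj, filter_insert, filter_insert,
    if_neg (lt_irrefl a), if_neg (lt_irrefl b), hpos] at h
  have hu : IsUnit ((-1 : ZMod q) ^ (U.filter (· < b)).card) := (isUnit_one.neg).pow _
  exact hu.mul_left_cancel h

/-- If all alternating sums over sets obtained by deleting one element of `T` vanish, then `v` is
constant on `T`. -/
lemma constant_of_alternatingSum_erase {n q : ℕ} (v : Fin n → ZMod q) (T : Finset (Fin n))
    (h : ∀ i ∈ T, alternatingSum v (T.erase i) = 0) {a b : Fin n} (ha : a ∈ T) (hb : b ∈ T) :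
    v a = v b := by
  have hT : T.Nonempty := ⟨a, ha⟩
  suffices H : ∀ b ∈ T, v b = v (T.min' hT) by rw [H a ha, H b hb]
  intro b
  induction b using WellFoundedLT.induction with
  | ind b ih =>
    intro hb
    by_cases hbm : b = T.min' hT
    · rw [← hbm]
    have hlt : T.min' hT < b := lt_of_le_of_ne (T.min'_le b hb) (Ne.symm hbm)
    have hne : (T.filter (· < b)).Nonempty := ⟨_, mem_filter.2 ⟨T.min'_mem hT, hlt⟩⟩
    obtain ⟨p, hp, hmax⟩ : ∃ p ∈ T.filter (· < b), ∀ j ∈ T.filter (· < b), j ≤ p :=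
      ⟨_, max'_mem _ hne, fun j hj => le_max' _ j hj⟩
    rw [mem_filter] at hp
    rw [← ih p hp.2 hp.1]
    refine eq_of_alternatingSum_insert_eq v ((T.erase p).erase b) (by simp) (by simp) ?_ ?_
    · intro i hi
      simp only [mem_erase] at hi
      constructor
      · intro hib
        exact lt_of_le_of_ne (hmax i (mem_filter.2 ⟨hi.2.2, hib⟩)) hi.2.1
      · intro hip
        exact hip.trans hp.2
    · rw [insert_erase (mem_erase.2 ⟨hp.2.ne', hb⟩), erase_right_comm,
        insert_erase (mem_erase.2 ⟨hp.2.ne, hp.1⟩), h p hp.1, h b hb]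

/-- The function `f` takes a single value on `T`. -/
def ConstantOn {α β : Type*} (f : α → β) (T : Finset α) : Prop :=
  ∀ a ∈ T, ∀ b ∈ T, f a = f b

lemma pow_le_pow_mul_choose {r s : ℕ} (h : r ≤ s) : s ^ r ≤ r ^ r * s.choose r := by
  induction r generalizing s with
  | zero => simp
  | succ r ih =>
    obtain ⟨s, rfl⟩ : ∃ t, s = t + 1 := ⟨s - 1, by omega⟩
    have key : r * (s + 1) ≤ (r + 1) * s := by nlinarith
    refine Nat.le_of_mul_le_mul_left (c := r ^ r) ?_ Nat.pow_self_pos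
    calc r ^ r * (s + 1) ^ (r + 1)
        = (r * (s + 1)) ^ r * (s + 1) := by rw [mul_pow]; ring
      _ ≤ ((r + 1) * s) ^ r * (s + 1) := Nat.mul_le_mul_right _ (Nat.pow_le_pow_left key r)
      _ = (r + 1) ^ r * (s + 1) * s ^ r := by rw [mul_pow]; ring
      _ ≤ (r + 1) ^ r * (s + 1) * (r ^ r * s.choose r) :=
        Nat.mul_le_mul_left _ (ih (by omega))
      _ = r ^ r * ((r + 1) ^ r * ((s + 1) * s.choose r)) := by ring
      _ = r ^ r * ((r + 1) ^ (r + 1) * (s + 1).choose (r + 1)) := by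
        rw [Nat.add_one_mul_choose_eq]; ring

lemma choose_mul_sq_le {m s : ℕ} (hms : m ≤ s) {r : ℕ} (hr : 2 ≤ r) :
    m.choose r * s ^ 2 ≤ m ^ 2 * s.choose r := by
  induction r, hr using Nat.le_induction with
  | base =>
    rcases m with _ | m
    · simp
    obtain ⟨s, rfl⟩ : ∃ t, s = t + 1 := ⟨s - 1, by omega⟩
    have h1 : (m + 1).choose 2 * 2 = (m + 1) * m := by
      have := Nat.add_one_mul_choose_eq m 1
      simpa using this.symm
    have h2 : (s + 1).choose 2 * 2 = (s + 1) * s := by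
      have := Nat.add_one_mul_choose_eq s 1
      simpa using this.symm
    have key : m * (s + 1) ≤ (m + 1) * s := by nlinarith
    refine Nat.le_of_mul_le_mul_right (c := 2) ?_ (by norm_num)
    calc (m + 1).choose 2 * (s + 1) ^ 2 * 2
        = ((m + 1).choose 2 * 2) * (s + 1) ^ 2 := by ring
      _ = ((m + 1) * (s + 1)) * (m * (s + 1)) := by rw [h1]; ring
      _ ≤ ((m + 1) * (s + 1)) * ((m + 1) * s) := Nat.mul_le_mul_left _ key
      _ = (m + 1) ^ 2 * ((s + 1) * s) := by ring
      _ = (m + 1) ^ 2 * (s + 1).choose 2 * 2 := by rw [← h2]; ring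
  | succ r hr ih =>
    refine Nat.le_of_mul_le_mul_right (c := r + 1) ?_ (by omega)
    calc m.choose (r + 1) * s ^ 2 * (r + 1)
        = (m.choose (r + 1) * (r + 1)) * s ^ 2 := by ring
      _ = (m.choose r * s ^ 2) * (m - r) := by rw [Nat.choose_succ_right_eq]; ring
      _ ≤ (m ^ 2 * s.choose r) * (s - r) := Nat.mul_le_mul ih (by omega)
      _ = m ^ 2 * (s.choose (r + 1) * (r + 1)) := by rw [Nat.choose_succ_right_eq]; ring
      _ = m ^ 2 * s.choose (r + 1) * (r + 1) := by ring

/-- If every fibre of `f` on `S` has at most `ε * #S` elements, then at most an `ε`-proportion of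
the `r`-subsets of `S` lie in a single fibre. -/
lemma card_filter_constant_le {α β : Type*} [DecidableEq β] (S : Finset α) (f : α → β) {ε : ℝ}
    (hS : ∀ x ∈ S.image f, ((S.filter fun i => f i = x).card : ℝ) ≤ ε * S.card)
    {r : ℕ} (hr : 2 ≤ r) :
    (((powersetCard r S).filter fun T => ConstantOn f T).card : ℝ) ≤
      ε * (S.card.choose r : ℝ) := by
  have hsub : ((powersetCard r S).filter fun T => ConstantOn f T) ⊆
      (S.image f).biUnion fun x => powersetCard r (S.filter fun i => f i = x) := by
    intro T hT
    rw [mem_filter, mem_powersetCard] at hT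
    obtain ⟨⟨hTS, hTr⟩, hc⟩ := hT
    obtain ⟨a, ha⟩ : T.Nonempty := card_pos.1 (by omega)
    exact mem_biUnion.2 ⟨f a, mem_image_of_mem f (hTS ha), mem_powersetCard.2
      ⟨fun b hb => mem_filter.2 ⟨hTS hb, hc b hb a ha⟩, hTr⟩⟩
  have hcard := (card_le_card hsub).trans card_biUnion_le
  simp only [card_powersetCard] at hcard
  rcases S.eq_empty_or_nonempty with rfl | hne
  · simp at hcard
    simpa [Nat.choose_eq_zero_of_lt (show 0 < r by omega)] using hcard
  have hs : (0 : ℝ) < S.card := by exact_mod_cast hne.card_pos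
  have hsum : ∑ x ∈ S.image f, ((S.filter fun i => f i = x).card : ℝ) = S.card := by
    exact_mod_cast (card_eq_sum_card_image f S).symm
  refine le_of_mul_le_mul_right ?_ (pow_pos hs 2)
  calc (((powersetCard r S).filter fun T => ConstantOn f T).card : ℝ) * S.card ^ 2
      ≤ (∑ x ∈ S.image f, ((S.filter fun i => f i = x).card.choose r : ℝ)) * S.card ^ 2 := by
        gcongr
        exact_mod_cast hcard
    _ = ∑ x ∈ S.image f, ((S.filter fun i => f i = x).card.choose r : ℝ) * S.card ^ 2 :=
        sum_mul _ _ _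
    _ ≤ ∑ x ∈ S.image f, ((S.filter fun i => f i = x).card : ℝ) *
          (ε * S.card * S.card.choose r) := by
        refine sum_le_sum fun x hx => ?_
        have h1 : ((S.filter fun i => f i = x).card.choose r : ℝ) * S.card ^ 2 ≤
            ((S.filter fun i => f i = x).card : ℝ) ^ 2 * S.card.choose r := by
          exact_mod_cast choose_mul_sq_le (card_filter_le _ _) hr
        refine h1.trans ?_
        rw [sq, mul_assoc]
        gcongr
        exact hS x hx
    _ = ε * S.card.choose r * S.card ^ 2 := by rw [← sum_mul, hsum]; ring

/-- A nonconstant `(k + 1)`-subset contains a `k`-subset with nonzero alternating sum. -/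
lemma card_nonconstant_le {n q : ℕ} (k : ℕ) (v : Fin n → ZMod q) (S : Finset (Fin n)) :
    ((powersetCard (k + 1) S).filter fun T => ¬ ConstantOn v T).card ≤
      ((powersetCard k univ).filter fun T => alternatingSum v T ≠ 0).card * S.card := by
  rw [← card_product]
  refine (card_le_card ?_).trans
    (card_image_le (f := fun p : Finset (Fin n) × Fin n => insert p.2 p.1))
  intro T hT
  rw [mem_filter, mem_powersetCard] at hT
  obtain ⟨⟨hTS, hTk⟩, hc⟩ := hT
  obtain ⟨i, hi, hne⟩ : ∃ i ∈ T, alternatingSum v (T.erase i) ≠ 0 := by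
    by_contra! hall
    exact hc fun a ha b hb => constant_of_alternatingSum_erase v T hall ha hb
  refine mem_image.2 ⟨(T.erase i, i), mem_product.2 ⟨mem_filter.2 ⟨?_, hne⟩, hTS hi⟩,
    insert_erase hi⟩
  rw [mem_powersetCard_univ, card_erase_of_mem hi, hTk, Nat.add_sub_cancel]

/-- For `k ≥ 4` even and `0 < ε < (k-1)!/k^k` there is `γ = γ(k,ε) > 0`
such that for every `n`, every prime `q` and every `ε`-balanced `v ∈ (ℤ/qℤ)ⁿ`,
`|B_q(v)| ≥ γ·|supp(v)|^k`. -/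
theorem coisoperimetry_even (k : ℕ) (hk : 4 ≤ k) (heven : Even k)
    (ε : ℝ) (hε0 : 0 < ε) (hε1 : ε < ((k - 1).factorial : ℝ) / (k : ℝ) ^ k) :
    ∃ γ : ℝ, 0 < γ ∧ ∀ n q : ℕ, q.Prime → ∀ v : Fin n → ZMod q,
      EpsBalanced ε v → γ * (suppCard v : ℝ) ^ k ≤ ((Bq k q v).ncard : ℝ) := by
  have hk0 : (0 : ℝ) < k := by exact_mod_cast (show 0 < k by omega)
  have hεk : ε * k < 1 := by
    have hfac : ((k - 1).factorial : ℝ) ≤ (k : ℝ) ^ (k - 1) := by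
      exact_mod_cast (Nat.factorial_le_pow (k - 1)).trans (Nat.pow_le_pow_left (by omega) _)
    have hpow : (k : ℝ) ^ k = (k : ℝ) ^ (k - 1) * k := by
      rw [← pow_succ, Nat.sub_add_cancel (by omega)]
    rw [lt_div_iff₀ (by positivity), hpow] at hε1
    have hp : (0 : ℝ) < (k : ℝ) ^ (k - 1) := by positivity
    nlinarith
  have hε : ε < 1 := by
    have : (1 : ℝ) ≤ k := by exact_mod_cast (show 1 ≤ k by omega)
    nlinarith
  refine ⟨(1 - ε) / ((k : ℝ) + 1) ^ (k + 1), div_pos (by linarith) (by positivity), ?_⟩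
  intro n q _ v hv
  set S : Finset (Fin n) := univ.filter fun i => v i ≠ 0 with hS
  have hsupp : suppCard v = S.card := rfl
  rw [EpsBalanced, hsupp] at hv
  rw [hsupp]
  rcases S.eq_empty_or_nonempty with hE | hne
  · simp [hE, show k ≠ 0 by omega]
  have hs : (0 : ℝ) < S.card := by exact_mod_cast hne.card_pos
  have hks : k + 1 ≤ S.card := by
    obtain ⟨i, hi⟩ := hne
    have h1 : (1 : ℝ) ≤ ((univ.filter fun j => v j = v i).card : ℝ) := by
      exact_mod_cast card_pos.2 ⟨i, by simp⟩
    have h2 := h1.trans (hv (v i) (mem_filter.1 hi).2)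
    have h3 : (k : ℝ) < S.card := by
      by_contra! hle
      nlinarith
    exact_mod_cast h3
  have hconst := card_filter_constant_le S v (ε := ε) (r := k + 1) (fun x hx => by
    obtain ⟨i, hi, rfl⟩ := mem_image.1 hx
    refine le_trans ?_ (hv (v i) (mem_filter.1 hi).2)
    exact_mod_cast card_le_card
      (filter_subset_filter (fun j => v j = v i) (subset_univ S))) (by omega)
  have hnon : (((powersetCard (k + 1) S).filter fun T => ¬ ConstantOn v T).card : ℝ)
      ≤ ((Bq k q v).ncard : ℝ) * S.card := by
    exact_mod_cast (card_nonconstant_le k v S).trans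
      (Nat.mul_le_mul_right _ (card_alternatingSum_ne_zero_le k q v))
  have htotal := card_filter_add_card_filter_not (s := powersetCard (k + 1) S)
    (ConstantOn v)
  rw [card_powersetCard] at htotal
  have htotal' := congrArg (Nat.cast : ℕ → ℝ) htotal
  rw [Nat.cast_add] at htotal'
  have hchoose : (S.card : ℝ) ^ (k + 1) / ((k : ℝ) + 1) ^ (k + 1) ≤
      (S.card.choose (k + 1) : ℝ) := by
    rw [div_le_iff₀' (by positivity)]
    exact_mod_cast pow_le_pow_mul_choose hks
  refine le_of_mul_le_mul_right ?_ hs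
  calc (1 - ε) / ((k : ℝ) + 1) ^ (k + 1) * (S.card : ℝ) ^ k * S.card
      = (1 - ε) * ((S.card : ℝ) ^ (k + 1) / ((k : ℝ) + 1) ^ (k + 1)) := by ring
    _ ≤ (1 - ε) * S.card.choose (k + 1) :=
        mul_le_mul_of_nonneg_left hchoose (by linarith)
    _ ≤ (Bq k q v).ncard * S.card := by linarith
end

section
/- Let k ≥ 3, let q be a prime, let ε > 0, and let v ∈ (ℤ/qℤ)^n be ε-balanced. Then the number of vectors w ∈ V_{k,n} with supp(w) ⊆ supp(v) and w·v = 0 over ℤ/qℤ is at most C(|supp(v)|, k-1)·ε·|supp(v)|. Consequently, |B_q(v)| ≥ C(|supp(v)|, k) − C(|supp(v)|, k-1)·ε·|supp(v)|, where C(a,b) denotes the binomial coefficient. -/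
open Finset
open scoped Classical

/-- The vector supported on `S` whose entries on `S` are `1, -1, 1, -1, ...` in increasing
coordinate order. -/
def altVec {n : ℕ} (S : Finset (Fin n)) (i : Fin n) : ℤ :=
  if i ∈ S then (-1) ^ (S.filter (· < i)).card else 0

theorem altVec_ne_zero_iff {n : ℕ} (S : Finset (Fin n)) (i : Fin n) :
    altVec S i ≠ 0 ↔ i ∈ S := by
  by_cases h : i ∈ S <;> simp [altVec, h]

theorem filter_altVec_ne_zero {n : ℕ} (S : Finset (Fin n)) :
    univ.filter (fun i => altVec S i ≠ 0) = S := by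
  ext i
  simp only [mem_filter, mem_univ, true_and, altVec_ne_zero_iff]

theorem altVec_injective {n : ℕ} : Function.Injective (altVec (n := n)) := by
  intro S T h
  rw [← filter_altVec_ne_zero S, h, filter_altVec_ne_zero]

theorem memVkn_altVec {k n : ℕ} {S : Finset (Fin n)} (hS : S.card = k) :
    MemVkn k n (altVec S) := by
  refine ⟨by rw [filter_altVec_ne_zero, hS], fun i hi => ?_⟩
  rw [altVec_ne_zero_iff] at hi
  have : univ.filter (fun j => j < i ∧ altVec S j ≠ 0) = S.filter (· < i) := by
    ext j
    simp only [mem_filter, mem_univ, true_and, altVec_ne_zero_iff, and_comm]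
  rw [this, altVec, if_pos hi]

theorem MemVkn.eq_altVec {k n : ℕ} {w : Fin n → ℤ} (hw : MemVkn k n w) :
    w = altVec (univ.filter (fun i => w i ≠ 0)) := by
  funext i
  by_cases hi : w i = 0
  · simp [altVec, hi]
  · rw [altVec, if_pos (by simpa using hi), hw.2 i hi, filter_filter]
    simp only [and_comm]

/-- Vectors of `V_{k,n}` satisfying a condition correspond to their supports. -/
theorem setOf_memVkn_eq_image {k n : ℕ} (s : Finset (Fin n)) (P : (Fin n → ℤ) → Prop) :
    {w | MemVkn k n w ∧ (∀ i, w i ≠ 0 → i ∈ s) ∧ P w} =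
      altVec '' ((s.powersetCard k).filter (fun S => P (altVec S)) : Set (Finset (Fin n))) := by
  ext w
  simp only [Set.mem_ofPred_eq, Set.mem_image, coe_filter, mem_powersetCard]
  constructor
  · rintro ⟨hw, hs, hP⟩
    refine ⟨univ.filter (fun i => w i ≠ 0), ⟨⟨fun i hi => hs i (by simpa using hi), hw.1⟩, ?_⟩,
      hw.eq_altVec.symm⟩
    rwa [← hw.eq_altVec]
  · rintro ⟨S, ⟨⟨hs, hc⟩, hP⟩, rfl⟩
    exact ⟨memVkn_altVec hc, fun i hi => hs ((altVec_ne_zero_iff S i).1 hi), hP⟩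

theorem ncard_setOf_memVkn {k n : ℕ} (s : Finset (Fin n)) (P : (Fin n → ℤ) → Prop) :
    {w | MemVkn k n w ∧ (∀ i, w i ≠ 0 → i ∈ s) ∧ P w}.ncard =
      ((s.powersetCard k).filter (fun S => P (altVec S))).card := by
  rw [setOf_memVkn_eq_image, Set.ncard_image_of_injective _ altVec_injective,
    Set.ncard_coe_finset]

theorem sum_altVec_mul {R : Type*} [CommRing R] {n : ℕ} (S : Finset (Fin n)) (v : Fin n → R) :
    ∑ i, (altVec S i : R) * v i = ∑ i ∈ S, (-1) ^ (S.filter (· < i)).card * v i := by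
  rw [← Finset.sum_subset (subset_univ S)]
  · refine Finset.sum_congr rfl fun i hi => ?_
    simp [altVec, hi]
  · intro i _ hi
    simp [altVec, hi]

/-- Appending a coordinate `m` after all the elements of `T`. -/
theorem sum_altVec_insert_mul {R : Type*} [CommRing R] {n : ℕ} {T : Finset (Fin n)} {m : Fin n}
    (hm : ∀ j ∈ T, j < m) (v : Fin n → R) :
    ∑ i, (altVec (insert m T) i : R) * v i =
      (-1) ^ T.card * v m + ∑ i, (altVec T i : R) * v i := by
  have hmT : m ∉ T := fun h => lt_irrefl _ (hm m h)
  rw [sum_altVec_mul, sum_altVec_mul, Finset.sum_insert hmT]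
  congr 1
  · rw [Finset.filter_insert, if_neg (lt_irrefl m), Finset.filter_true_of_mem hm]
  · refine Finset.sum_congr rfl fun i hi => ?_
    rw [Finset.filter_insert, if_neg (hm i hi).not_gt]

/-- Removing the largest element. -/
def eraseMax {n : ℕ} (S : Finset (Fin n)) : Finset (Fin n) :=
  S.filter (fun i => ∃ j ∈ S, i < j)

theorem exists_eq_insert_eraseMax {n : ℕ} {S : Finset (Fin n)} (hS : S.Nonempty) :
    ∃ m, S = insert m (eraseMax S) ∧ ∀ j ∈ eraseMax S, j < m := by
  refine ⟨S.max' hS, ?_, ?_⟩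
  · ext i
    simp only [eraseMax, mem_insert, mem_filter]
    constructor
    · intro hi
      rcases (S.le_max' i hi).eq_or_lt with h | h
      · exact Or.inl h
      · exact Or.inr ⟨hi, _, S.max'_mem hS, h⟩
    · rintro (rfl | h)
      · exact S.max'_mem hS
      · exact h.1
  · intro j hj
    obtain ⟨-, l, hl, hjl⟩ := mem_filter.1 hj
    exact hjl.trans_le (S.le_max' l hl)

theorem card_orthogonal_le {k n q : ℕ} (hk : 1 ≤ k) {ε : ℝ} (hε : 0 ≤ ε)
    {v : Fin n → ZMod q} (hbal : EpsBalanced ε v) :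
    ((((univ.filter (fun i => v i ≠ 0)).powersetCard k).filter
        (fun S => ∑ i, (altVec S i : ZMod q) * v i = 0)).card : ℝ) ≤
      ((suppCard v).choose (k - 1) : ℝ) * ε * (suppCard v : ℝ) := by
  set s := univ.filter (fun i => v i ≠ 0) with hs
  set O := (s.powersetCard k).filter (fun S => ∑ i, (altVec S i : ZMod q) * v i = 0) with hO
  have split : ∀ S ∈ O, ∃ m, v m ≠ 0 ∧ eraseMax S ∈ s.powersetCard (k - 1) ∧
      S = insert m (eraseMax S) ∧
      v m = -((-1) ^ (k - 1) * ∑ i, (altVec (eraseMax S) i : ZMod q) * v i) := by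
    intro S hS
    obtain ⟨hSk, h0⟩ := mem_filter.1 hS
    obtain ⟨hsub, hcard⟩ := mem_powersetCard.1 hSk
    obtain ⟨m, hm, hlt⟩ := exists_eq_insert_eraseMax (card_pos.1 (by omega : 0 < S.card))
    have hmT : m ∉ eraseMax S := fun h => lt_irrefl _ (hlt m h)
    have hmS : m ∈ S := by rw [hm]; exact mem_insert_self _ _
    have hT : (eraseMax S).card = k - 1 := by
      have := card_insert_of_notMem hmT
      rw [← hm] at this
      omega
    refine ⟨m, (mem_filter.1 (hsub hmS)).2,
      mem_powersetCard.2 ⟨(filter_subset _ _).trans hsub, hT⟩, hm, ?_⟩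
    rw [hm, sum_altVec_insert_mul hlt, hT] at h0
    have hsq : ((-1 : ZMod q) ^ (k - 1)) * (-1) ^ (k - 1) = 1 := by
      rw [← mul_pow]; simp
    linear_combination ((-1 : ZMod q) ^ (k - 1)) * h0 - v m * hsq
  have hmaps : ∀ S ∈ O, eraseMax S ∈ s.powersetCard (k - 1) := fun S hS =>
    let ⟨_, _, h, _⟩ := split S hS
    h
  have hfib : ∀ T ∈ s.powersetCard (k - 1),
      ((O.filter (fun S => eraseMax S = T)).card : ℝ) ≤ ε * suppCard v := by
    intro T _
    set x : ZMod q := -((-1) ^ (k - 1) * ∑ i, (altVec T i : ZMod q) * v i) with hx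
    by_cases hx0 : x = 0
    · have : O.filter (fun S => eraseMax S = T) = ∅ := by
        refine filter_eq_empty_iff.2 fun S hS hST => ?_
        obtain ⟨m, hm0, -, -, hm⟩ := split S hS
        rw [hST, ← hx, hx0] at hm
        exact hm0 hm
      rw [this]
      simp only [card_empty, Nat.cast_zero]
      positivity
    · refine le_trans ?_ (hbal x hx0)
      have : O.filter (fun S => eraseMax S = T) ⊆
          (univ.filter (fun i => v i = x)).image (fun m => insert m T) := by
        intro S hS
        obtain ⟨hSO, rfl⟩ := mem_filter.1 hS
        obtain ⟨m, -, -, hSm, hm⟩ := split S hSO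
        exact mem_image.2 ⟨m, mem_filter.2 ⟨mem_univ _, hm⟩, hSm.symm⟩
      exact_mod_cast (card_le_card this).trans card_image_le
  rw [card_eq_sum_card_fiberwise hmaps, Nat.cast_sum]
  refine (Finset.sum_le_card_nsmul _ _ _ hfib).trans_eq ?_
  rw [card_powersetCard, nsmul_eq_mul, mul_assoc]
  rfl

/-- For `k ≥ 3`, `q` prime, `ε > 0` and `v ∈ (ℤ/qℤ)ⁿ` `ε`-balanced, the
number of `w ∈ V_{k,n}` with `supp(w) ⊆ supp(v)` that are orthogonal to `v` over `ℤ/qℤ` is at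
most `C(|supp(v)|, k-1)·ε·|supp(v)|`; consequently
`|B_q(v)| ≥ C(|supp(v)|, k) - C(|supp(v)|, k-1)·ε·|supp(v)|`. -/
theorem balanced_orthogonal_count (k n q : ℕ) (hk : 3 ≤ k) (hq : q.Prime)
    (ε : ℝ) (hε : 0 < ε) (v : Fin n → ZMod q) (hbal : EpsBalanced ε v) :
    ((({w | MemVkn k n w ∧ (∀ i, w i ≠ 0 → v i ≠ 0) ∧ ∑ i, (w i : ZMod q) * v i = 0} :
        Set (Fin n → ℤ)).ncard : ℝ) ≤
      ((suppCard v).choose (k - 1) : ℝ) * ε * (suppCard v : ℝ)) ∧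
    (((suppCard v).choose k : ℝ) - ((suppCard v).choose (k - 1) : ℝ) * ε * (suppCard v : ℝ)
      ≤ ((Bq k q v).ncard : ℝ)) := by
  set s := univ.filter (fun i => v i ≠ 0) with hs
  have hO := ncard_setOf_memVkn (k := k) s (fun w => ∑ i, (w i : ZMod q) * v i = 0)
  have hA := ncard_setOf_memVkn (k := k) s (fun _ => True)
  simp only [hs, mem_filter, mem_univ, true_and, and_true, filter_true, card_powersetCard]
    at hO hA
  have hbound : (({w | MemVkn k n w ∧ (∀ i, w i ≠ 0 → v i ≠ 0) ∧
      ∑ i, (w i : ZMod q) * v i = 0} : Set (Fin n → ℤ)).ncard : ℝ) ≤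
      ((suppCard v).choose (k - 1) : ℝ) * ε * (suppCard v : ℝ) := by
    rw [hO]
    convert card_orthogonal_le (one_le_two.trans (Nat.le_of_succ_le hk)) hε.le hbal
  refine ⟨hbound, ?_⟩
  have hfin : {w | MemVkn k n w}.Finite :=
    (Set.finite_range altVec).subset fun w hw => ⟨_, (MemVkn.eq_altVec hw).symm⟩
  have hcover : {w | MemVkn k n w ∧ ∀ i, w i ≠ 0 → v i ≠ 0} ⊆
      {w | MemVkn k n w ∧ (∀ i, w i ≠ 0 → v i ≠ 0) ∧ ∑ i, (w i : ZMod q) * v i = 0} ∪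
        Bq k q v := by
    rintro w ⟨hw, hsupp⟩
    by_cases h : ∑ i, (w i : ZMod q) * v i = 0
    · exact Or.inl ⟨hw, hsupp, h⟩
    · exact Or.inr ⟨hw, h⟩
  have hle := (Set.ncard_le_ncard hcover ((hfin.subset fun w hw => hw.1).union
    (hfin.subset fun w hw => hw.1))).trans (Set.ncard_union_le _ _)
  rw [hA] at hle
  have hle' : ((suppCard v).choose k : ℝ) ≤ _ := Nat.cast_le.2 hle
  push_cast at hle'
  linarith
end
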